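/- arXiv:1911.05910 — 2 statements merged into one kernel-verified Lean document; each statement's English description precedes it below -/
import Mathlib

section
/- For φ(x) := dim_H 𝐔(x): one has φ(x) > 0 if and only if x < M/(q_KL−1), and φ(x) = 1 if and only if 0 < x ≤ 1. -/
open scoped ENNReal NNReal Classical

namespace Expansions

/-- Digit sequences over the alphabet `{0,1,…,M}`; index `i : ℕ` represents the
`(i+1)`-st digit `d_{i+1}` of the paper. -/
abbrev Digits (M : ℕ) := ℕ → Fin (M + 1)

/-- `π_q((d_i)) = Σ_{i≥1} d_i / q^i`. -/
noncomputable def piQ (M : ℕ) (q : ℝ) (d : Digits M) : ℝ :=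
  ∑' i : ℕ, (d i : ℝ) / q ^ (i + 1)

/-- `𝒰_q` : the set of real numbers having a unique `q`-expansion. -/
def Uq (M : ℕ) (q : ℝ) : Set ℝ := {x | ∃! d : Digits M, piQ M q d = x}

/-- `𝐔_q` : the set of sequences that are the unique `q`-expansion of their value. -/
def UqSym (M : ℕ) (q : ℝ) : Set (Digits M) :=
  {d | ∀ e : Digits M, piQ M q e = piQ M q d → e = d}

/-- `𝒰(x)` : the set of univoque bases of `x`. -/
def Ubases (M : ℕ) (x : ℝ) : Set ℝ :=
  {q | q ∈ Set.Ioc (1 : ℝ) ((M : ℝ) + 1) ∧ x ∈ Uq M q}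

/-- `q_x = min{M+1, 1+M/x}`. -/
noncomputable def qx (M : ℕ) (x : ℝ) : ℝ := min ((M : ℝ) + 1) (1 + (M : ℝ) / x)

/-- Strict lexicographic order on digit sequences. -/
def lexLt {M : ℕ} (c d : Digits M) : Prop := ∃ n, (∀ i < n, c i = d i) ∧ c n < d n

def lexLe {M : ℕ} (c d : Digits M) : Prop := c = d ∨ lexLt c d

/-- The sequence ends with `0^∞`. -/
def EndsInZero {M : ℕ} (d : Digits M) : Prop := ∃ N, ∀ n ≥ N, d n = 0

/-- `d` is the quasi-greedy `q`-expansion of `x`: the lexicographically largest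
`q`-expansion of `x` not ending with `0^∞`. -/
def IsQuasiGreedy (M : ℕ) (q x : ℝ) (d : Digits M) : Prop :=
  piQ M q d = x ∧ ¬ EndsInZero d ∧
    ∀ e : Digits M, piQ M q e = x → ¬ EndsInZero e → lexLe e d

/-- `Φ_x(q)`: the quasi-greedy `q`-expansion of `x` (junk value if none exists). -/
noncomputable def Phi (M : ℕ) (x q : ℝ) : Digits M :=
  if h : ∃ d : Digits M, IsQuasiGreedy M q x d then h.choose else fun _ => 0

/-- `𝐔(x) = {Φ_x(q) : q ∈ 𝒰(x)}`. -/
def UxSym (M : ℕ) (x : ℝ) : Set (Digits M) := (Phi M x) '' (Ubases M x)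

/-- `ρ((c_i),(d_i)) = (M+1)^{-inf{i ≥ 1 : c_i ≠ d_i}}` (our index `n` represents the
`(n+1)`-st digit, whence the exponent `-(n+1)`); `ρ(c,c) = 0`. -/
noncomputable def rho (M : ℕ) (c d : Digits M) : ℝ :=
  if c = d then 0
  else ((M : ℝ) + 1) ^ (-(((sInf {i | c i ≠ d i} : ℕ) : ℤ) + 1))

/-- Diameter of a set with respect to a distance function, valued in `ℝ≥0∞`. -/
noncomputable def gdiam {X : Type*} (dist : X → X → ℝ) (A : Set X) : ℝ≥0∞ :=
  ⨆ x ∈ A, ⨆ y ∈ A, ENNReal.ofReal (dist x y)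

/-- The `s`-dimensional Hausdorff outer measure with respect to a distance function:
`lim_{δ→0⁺} inf {Σ diam(C n)^s : A ⊆ ⋃ C n, diam (C n) ≤ δ}`. -/
noncomputable def gHMeasure {X : Type*} (dist : X → X → ℝ) (s : ℝ) (A : Set X) : ℝ≥0∞ :=
  ⨆ (δ : ℝ) (_ : 0 < δ),
    ⨅ (C : ℕ → Set X) (_ : A ⊆ ⋃ n, C n)
      (_ : ∀ n, gdiam dist (C n) ≤ ENNReal.ofReal δ),
      ∑' n, gdiam dist (C n) ^ s

/-- Hausdorff dimension with respect to a distance function. -/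
noncomputable def gdimH {X : Type*} (dist : X → X → ℝ) (A : Set X) : ℝ≥0∞ :=
  ⨆ (s : ℝ≥0) (_ : gHMeasure dist (s : ℝ) A = ⊤), (s : ℝ≥0∞)

/-- The generalized golden ratio `q_G`. -/
noncomputable def qG (M : ℕ) : ℝ :=
  if M % 2 = 0 then ((M / 2 : ℕ) : ℝ) + 1
  else (((M / 2 : ℕ) : ℝ) + 1 +
    Real.sqrt (((M / 2 : ℕ) : ℝ) ^ 2 + 6 * ((M / 2 : ℕ) : ℝ) + 5)) / 2

/-- `x_G = M/(q_G - 1)`. -/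
noncomputable def xG (M : ℕ) : ℝ := (M : ℝ) / (qG M - 1)

/-- The Komornik–Loreti constant `q_KL = min 𝒰(1)`. -/
noncomputable def qKL (M : ℕ) : ℝ := sInf (Ubases M 1)

/-- `x_KL = M/(q_KL - 1)`. -/
noncomputable def xKL (M : ℕ) : ℝ := (M : ℝ) / (qKL M - 1)

/-- `X_iso`: the set of `x > 0` such that `𝒰(x)` contains an isolated point. -/
def Xiso (M : ℕ) : Set ℝ :=
  {x | 0 < x ∧ ∃ q ∈ Ubases M x, ∃ ε > 0, Ubases M x ∩ Set.Ioo (q - ε) (q + ε) = {q}}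

/-- The bifurcation set `𝒱 = {q ∈ (1,M+1] : 𝐔_r ≠ 𝐔_q for all r > q}`. -/
def Vset (M : ℕ) : Set ℝ :=
  {q | q ∈ Set.Ioc (1 : ℝ) ((M : ℝ) + 1) ∧
    ∀ r ∈ Set.Ioc (1 : ℝ) ((M : ℝ) + 1), q < r → UqSym M r ≠ UqSym M q}

/-- The Thue–Morse sequence `τ_i` = parity of the binary digit sum of `i`. -/
def tm (i : ℕ) : ℕ := (Nat.digits 2 i).sum % 2


section

variable {M : ℕ}

/-- The left shift by `n` places. -/
def shift (n : ℕ) (d : Digits M) : Digits M := fun i => d (n + i)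

/-- The reflection `d ↦ M - d`. -/
def refl (d : Digits M) : Digits M := fun i => (d i).rev

/-- The sequence whose first `N` digits are those of `w`, followed by `c`. -/
def prep (N : ℕ) (w c : Digits M) : Digits M := fun i => if i < N then w i else c (i - N)

@[simp] lemma shift_zero (d : Digits M) : shift 0 d = d := by
  funext i; simp [shift]

@[simp] lemma shift_apply (n i : ℕ) (d : Digits M) : shift n d i = d (n + i) := rfl

@[simp] lemma refl_apply (i : ℕ) (d : Digits M) : refl d i = (d i).rev := rfl

lemma shift_shift (m n : ℕ) (d : Digits M) : shift m (shift n d) = shift (n + m) d := by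
  funext i; simp [shift, add_assoc]

lemma shift_refl (n : ℕ) (d : Digits M) : shift n (refl d) = refl (shift n d) := rfl

@[simp] lemma refl_refl (d : Digits M) : refl (refl d) = d := by
  funext i; simp

lemma val_rev_add (a : Fin (M + 1)) : (a.rev : ℕ) + a = M := by
  have := a.isLt
  rw [Fin.val_rev]; omega

lemma cast_rev (a : Fin (M + 1)) : ((a.rev : ℕ) : ℝ) = M - (a : ℕ) := by
  have := val_rev_add a
  rw [eq_sub_iff_add_eq]; exact_mod_cast this

lemma shift_prep (N : ℕ) (w c : Digits M) (n : ℕ) : shift (N + n) (prep N w c) = shift n c := by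
  funext i
  simp only [shift_apply, prep]
  rw [if_neg (by omega)]
  congr 1; omega

lemma shift_prep_self (N : ℕ) (w c : Digits M) : shift N (prep N w c) = c := by
  simpa using shift_prep N w c 0

lemma hasSum_const_div {q : ℝ} (hq : 1 < q) :
    HasSum (fun i : ℕ => (M : ℝ) / q ^ (i + 1)) (M / (q - 1)) := by
  have h0 : (0 : ℝ) < q := by linarith
  have h := (hasSum_geometric_of_lt_one (r := 1 / q) (by positivity)
    (by rw [div_lt_one h0]; exact hq)).mul_left ((M : ℝ) / q)
  have h1 : (fun i : ℕ => (M : ℝ) / q ^ (i + 1)) = fun i => (M : ℝ) / q * (1 / q) ^ i := by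
    funext i
    rw [pow_succ, one_div, inv_pow]
    field_simp
  have h2 : (M : ℝ) / (q - 1) = (M : ℝ) / q * (1 - 1 / q)⁻¹ := by
    have : q - 1 ≠ 0 := by linarith
    have : 1 - 1 / q = (q - 1) / q := by field_simp
    rw [this]; field_simp
  rw [h1, h2]; exact h

lemma summable_piQ {q : ℝ} (hq : 1 < q) (d : Digits M) :
    Summable fun i : ℕ => (d i : ℝ) / q ^ (i + 1) := by
  have h0 : (0 : ℝ) < q := by linarith
  refine Summable.of_nonneg_of_le (fun i => by positivity) (fun i => ?_)
    (hasSum_const_div (M := M) hq).summable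
  gcongr
  exact Nat.lt_succ_iff.mp (d i).isLt

lemma piQ_nonneg {q : ℝ} (hq : 1 < q) (d : Digits M) : 0 ≤ piQ M q d := by
  have h0 : (0 : ℝ) < q := by linarith
  exact tsum_nonneg fun i => by positivity

lemma piQ_mono {q : ℝ} (hq : 1 < q) {d e : Digits M} (h : ∀ i, d i ≤ e i) :
    piQ M q d ≤ piQ M q e := by
  have h0 : (0 : ℝ) < q := by linarith
  refine (summable_piQ hq d).tsum_le_tsum (fun i => ?_) (summable_piQ hq e)
  gcongr
  exact h i

lemma piQ_add_refl {q : ℝ} (hq : 1 < q) (d : Digits M) :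
    piQ M q d + piQ M q (refl d) = M / (q - 1) := by
  rw [piQ, piQ, ← (summable_piQ hq d).tsum_add (summable_piQ hq (refl d)),
    ← (hasSum_const_div (M := M) hq).tsum_eq]
  congr 1; funext i
  rw [refl_apply, cast_rev, ← add_div]; ring

lemma piQ_le {q : ℝ} (hq : 1 < q) (d : Digits M) : piQ M q d ≤ M / (q - 1) := by
  have := piQ_add_refl hq d
  have := piQ_nonneg hq (refl d)
  linarith

lemma piQ_last {q : ℝ} (hq : 1 < q) : piQ M q (fun _ => Fin.last M) = M / (q - 1) := by
  rw [← (hasSum_const_div (M := M) hq).tsum_eq]; rfl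

lemma piQ_eq_prefix {q : ℝ} (hq : 1 < q) (d : Digits M) (n : ℕ) :
    piQ M q d = ∑ i ∈ Finset.range n, (d i : ℝ) / q ^ (i + 1) + piQ M q (shift n d) / q ^ n := by
  have h0 : (0 : ℝ) < q := by linarith
  rw [piQ, ← (summable_piQ hq d).sum_add_tsum_nat_add n]
  congr 1
  rw [piQ, ← tsum_div_const]
  congr 1; funext i
  rw [shift_apply, add_comm n i, div_div]
  congr 1; ring

lemma piQ_succ {q : ℝ} (hq : 1 < q) (d : Digits M) :
    piQ M q d = ((d 0 : ℝ) + piQ M q (shift 1 d)) / q := by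
  rw [piQ_eq_prefix hq d 1]; simp; ring

lemma piQ_shift_succ {q : ℝ} (hq : 1 < q) (d : Digits M) (n : ℕ) :
    piQ M q (shift n d) = ((d n : ℝ) + piQ M q (shift (n + 1) d)) / q := by
  rw [piQ_succ hq, shift_shift]; rfl

lemma piQ_sub_of_agree {q : ℝ} (hq : 1 < q) {d e : Digits M} {n : ℕ}
    (h : ∀ i < n, d i = e i) :
    piQ M q d - piQ M q e = (piQ M q (shift n d) - piQ M q (shift n e)) / q ^ n := by
  rw [piQ_eq_prefix hq d n, piQ_eq_prefix hq e n, Finset.sum_congr rfl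
    (fun i hi => by rw [h i (Finset.mem_range.mp hi)]), sub_div]
  ring

lemma piQ_sub_of_agree_succ {q : ℝ} (hq : 1 < q) {d e : Digits M} {n : ℕ}
    (h : ∀ i < n, d i = e i) :
    piQ M q d - piQ M q e = (((d n : ℝ) + piQ M q (shift (n + 1) d)) -
      ((e n : ℝ) + piQ M q (shift (n + 1) e))) / q ^ (n + 1) := by
  rw [piQ_sub_of_agree hq h, piQ_shift_succ hq d, piQ_shift_succ hq e, ← sub_div, div_div, pow_succ']

lemma abs_piQ_sub_le {q : ℝ} (hq : 1 < q) {d e : Digits M} {n : ℕ}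
    (h : ∀ i < n, d i = e i) :
    |piQ M q d - piQ M q e| ≤ M / (q - 1) / q ^ n := by
  have h0 : (0 : ℝ) < q := by linarith
  rw [piQ_sub_of_agree hq h, abs_div, abs_of_pos (pow_pos h0 n)]
  gcongr
  rw [abs_le]
  constructor <;>
  linarith [piQ_nonneg hq (shift n d), piQ_le hq (shift n d), piQ_nonneg hq (shift n e),
    piQ_le hq (shift n e)]

lemma piQ_antitone {p q : ℝ} (hp : 1 < p) (hpq : p ≤ q) (d : Digits M) :
    piQ M q d ≤ piQ M p d := by
  have h0 : (0 : ℝ) < p := by linarith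
  refine (summable_piQ (hp.trans_le hpq) d).tsum_le_tsum (fun i => ?_) (summable_piQ hp d)
  gcongr

lemma digit_le_piQ {q : ℝ} (hq : 1 < q) (d : Digits M) (i : ℕ) :
    (d i : ℝ) / q ^ (i + 1) ≤ piQ M q d := by
  have h0 : (0 : ℝ) < q := by linarith
  exact (summable_piQ hq d).le_tsum i fun j _ => by positivity

lemma digit_sub_le_piQ_sub {p q : ℝ} (hp : 1 < p) (hpq : p ≤ q) (d : Digits M) (i : ℕ) :
    (d i : ℝ) / p ^ (i + 1) - (d i : ℝ) / q ^ (i + 1) ≤ piQ M p d - piQ M q d := by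
  have h0 : (0 : ℝ) < p := by linarith
  have hs1 := summable_piQ hp d
  have hs2 := summable_piQ (hp.trans_le hpq) d
  rw [piQ, piQ, ← hs1.tsum_sub hs2]
  refine (hs1.sub hs2).le_tsum i fun j _ => ?_
  rw [sub_nonneg]
  gcongr

lemma piQ_strictAnti {p q : ℝ} (hp : 1 < p) (hpq : p < q) {d : Digits M} {i : ℕ} (hi : d i ≠ 0) :
    piQ M q d < piQ M p d := by
  have h0 : (0 : ℝ) < p := by linarith
  have := digit_sub_le_piQ_sub hp hpq.le d i
  have hd : (0 : ℝ) < (d i : ℕ) := by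
    exact_mod_cast Nat.pos_of_ne_zero (fun h => hi (Fin.ext h))
  have : (d i : ℝ) / q ^ (i + 1) < (d i : ℝ) / p ^ (i + 1) := by gcongr
  linarith

lemma piQ_pos {q : ℝ} (hq : 1 < q) {d : Digits M} {i : ℕ} (hi : d i ≠ 0) : 0 < piQ M q d := by
  have h0 : (0 : ℝ) < q := by linarith
  have hd : (0 : ℝ) < (d i : ℕ) := by
    exact_mod_cast Nat.pos_of_ne_zero (fun h => hi (Fin.ext h))
  exact lt_of_lt_of_le (by positivity) (digit_le_piQ hq d i)

lemma continuousOn_piQ {a : ℝ} (ha : 1 < a) (d : Digits M) :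
    ContinuousOn (fun q => piQ M q d) (Set.Ici a) := by
  have h0 : (0 : ℝ) < a := by linarith
  refine continuousOn_tsum (u := fun i : ℕ => (M : ℝ) / a ^ (i + 1)) (fun i => ?_)
    (hasSum_const_div ha).summable (fun i q hq => ?_)
  · refine continuousOn_const.div (continuousOn_pow _) fun q hq => ?_
    have : 0 < q := h0.trans_le hq
    positivity
  · have hq' : a ≤ q := hq
    have h1 : 0 < q := h0.trans_le hq
    rw [Real.norm_of_nonneg (by positivity)]
    gcongr
    exact Nat.lt_succ_iff.mp (d i).isLt

/-- A base in which a given sequence represents `x`, by the intermediate value theorem. -/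
lemma exists_base {a b x : ℝ} (ha : 1 < a) (hab : a ≤ b) (d : Digits M)
    (h1 : piQ M b d ≤ x) (h2 : x ≤ piQ M a d) : ∃ q ∈ Set.Icc a b, piQ M q d = x :=
  intermediate_value_Icc' hab ((continuousOn_piQ ha d).mono fun _ h => h.1) ⟨h1, h2⟩

/-- A set of remainders stable under extracting a digit yields expansions. -/
lemma exists_expansion_of_invariant {q : ℝ} (hq : 1 < q) {I : Set ℝ} {K : ℝ}
    (hI : I ⊆ Set.Icc 0 K)
    (hstep : ∀ r ∈ I, ∃ a : Fin (M + 1), q * r - (a : ℕ) ∈ I) {x : ℝ} (hx : x ∈ I) :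
    ∃ d : Digits M, ∀ n, piQ M q (shift n d) ∈ I ∧ (n = 0 → piQ M q (shift n d) = x) := by
  have h0 : (0 : ℝ) < q := by linarith
  choose! dig hdig using hstep
  let r : ℕ → ℝ := fun n => Nat.rec x (fun _ y => q * y - (dig y : ℕ)) n
  have hr : ∀ n, r n ∈ I := by
    intro n
    induction n with
    | zero => exact hx
    | succ n ih => exact hdig _ ih
  have hrs : ∀ n, r (n + 1) = q * r n - (dig (r n) : ℕ) := fun n => rfl
  let d : Digits M := fun n => dig (r n)
  have hpart : ∀ n m, r n = ∑ i ∈ Finset.range m, (d (n + i) : ℝ) / q ^ (i + 1)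
      + r (n + m) / q ^ m := by
    intro n m
    induction m with
    | zero => simp
    | succ m ih =>
      rw [Finset.sum_range_succ, ih, ← add_assoc, hrs, sub_div, pow_succ']
      simp only [d]
      field_simp
      ring
  have hval : ∀ n, piQ M q (shift n d) = r n := by
    intro n
    have h1 := (summable_piQ hq (shift n d)).hasSum.tendsto_sum_nat
    have h2 : Filter.Tendsto (fun m => r (n + m) / q ^ m) Filter.atTop (nhds 0) := by
      have h3 : Filter.Tendsto (fun m : ℕ => K * (1 / q) ^ m) Filter.atTop (nhds 0) := by
        simpa using (tendsto_pow_atTop_nhds_zero_of_lt_one (r := 1 / q) (by positivity)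
          (by rw [div_lt_one h0]; exact hq)).const_mul K
      refine squeeze_zero (fun m => div_nonneg (hI (hr _)).1 (by positivity)) (fun m => ?_) h3
      rw [one_div, inv_pow, ← div_eq_mul_inv]
      gcongr
      exact (hI (hr _)).2
    have h3 : Filter.Tendsto (fun m => r n - r (n + m) / q ^ m) Filter.atTop (nhds (r n)) := by
      simpa using h2.const_sub (r n)
    refine tendsto_nhds_unique h1 (h3.congr fun m => ?_)
    rw [hpart n m]; simp
  refine ⟨d, fun n => ?_⟩
  rw [hval]
  exact ⟨hr n, fun h => by subst h; rfl⟩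

lemma exists_expansion {q x : ℝ} (hq : 1 < q) (hqM : q ≤ M + 1)
    (hx : x ∈ Set.Icc (0 : ℝ) (M / (q - 1))) : ∃ d : Digits M, piQ M q d = x := by
  have h0 : (0 : ℝ) < q := by linarith
  suffices hstep : ∀ r ∈ Set.Icc (0 : ℝ) (M / (q - 1)), ∃ a : Fin (M + 1),
      q * r - (a : ℕ) ∈ Set.Icc (0 : ℝ) (M / (q - 1)) by
    obtain ⟨d, hd⟩ := exists_expansion_of_invariant hq subset_rfl hstep hx
    exact ⟨d, by simpa using (hd 0).2 rfl⟩
  intro r hr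
  have hr0 := hr.1
  by_cases h : (M : ℝ) ≤ q * r
  · refine ⟨Fin.last M, ?_, ?_⟩
    · simpa using h
    · have h1 := mul_le_mul_of_nonneg_left hr.2 h0.le
      have : q * (M / (q - 1)) - M = M / (q - 1) := by
        have : q - 1 ≠ 0 := by linarith
        field_simp
        ring
      simp only [Fin.val_last]; linarith
  · push Not at h
    have h1 : ⌊q * r⌋₊ < M + 1 := by
      have := Nat.floor_le (show 0 ≤ q * r by positivity)
      have h2 : (⌊q * r⌋₊ : ℝ) < M := by linarith
      have : ⌊q * r⌋₊ < M := by exact_mod_cast h2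
      omega
    refine ⟨⟨⌊q * r⌋₊, h1⟩, ?_, ?_⟩
    · have := Nat.floor_le (show 0 ≤ q * r by positivity)
      simp only; linarith
    · have := Nat.lt_floor_add_one (q * r)
      have h3 : 1 ≤ (M : ℝ) / (q - 1) := by
        rw [le_div_iff₀ (by linarith)]; linarith
      simp only; linarith

/-- The quasi-greedy expansion of `x ∈ (0, 1]` in base `M + 1`: all remainders lie in `(0, 1]`. -/
lemma exists_quasiGreedy_integer_base (hM : 0 < M) {x : ℝ} (hx : x ∈ Set.Ioc (0 : ℝ) 1) :
    ∃ d : Digits M, piQ M (M + 1) d = x ∧ ∀ n, piQ M (M + 1) (shift n d) ∈ Set.Ioc (0 : ℝ) 1 := by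
  have hM' : (0 : ℝ) < M := by exact_mod_cast hM
  suffices hstep : ∀ r ∈ Set.Ioc (0 : ℝ) 1, ∃ a : Fin (M + 1),
      ((M : ℝ) + 1) * r - (a : ℕ) ∈ Set.Ioc (0 : ℝ) 1 by
    obtain ⟨d, hd⟩ := exists_expansion_of_invariant (q := M + 1) (K := 1) (by linarith)
      (fun y h => ⟨h.1.le, h.2⟩) hstep hx
    exact ⟨d, by simpa using (hd 0).2 rfl, fun n => (hd n).1⟩
  intro r hr
  have hr0 := hr.1
  have hpos : 0 < ((M : ℝ) + 1) * r := by positivity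
  have h1 : 0 < ⌈((M : ℝ) + 1) * r⌉₊ := Nat.ceil_pos.mpr hpos
  have h2 : ⌈((M : ℝ) + 1) * r⌉₊ ≤ M + 1 := by
    rw [Nat.ceil_le]; push_cast
    nlinarith [hr.2]
  have h3 := Nat.ceil_lt_add_one hpos.le
  have h4 := Nat.le_ceil (((M : ℝ) + 1) * r)
  refine ⟨⟨⌈((M : ℝ) + 1) * r⌉₊ - 1, by omega⟩, ?_⟩
  simp only [Nat.cast_sub (show 1 ≤ ⌈((M : ℝ) + 1) * r⌉₊ from h1), Nat.cast_one]
  constructor <;> linarith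

/-- The value conditions characterizing unique expansions. -/
def Tame (q : ℝ) (d : Digits M) : Prop :=
  (∀ n, d n ≠ Fin.last M → piQ M q (shift (n + 1) d) < 1) ∧
  (∀ n, d n ≠ 0 → piQ M q (refl (shift (n + 1) d)) < 1)

lemma lexLt_trichotomy (c d : Digits M) : lexLt c d ∨ c = d ∨ lexLt d c := by
  by_cases h : c = d
  · exact Or.inr (Or.inl h)
  have hex : ∃ n, c n ≠ d n := by
    by_contra hcon
    push Not at hcon
    exact h (funext hcon)
  have hmin : ∀ i < Nat.find hex, c i = d i := fun i hi => by
    simpa using Nat.find_min hex hi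
  rcases lt_or_gt_of_ne (Nat.find_spec hex) with h1 | h1
  · exact Or.inl ⟨_, hmin, h1⟩
  · exact Or.inr (Or.inr ⟨_, fun i hi => (hmin i hi).symm, h1⟩)

lemma piQ_refl {q : ℝ} (hq : 1 < q) (d : Digits M) :
    piQ M q (refl d) = M / (q - 1) - piQ M q d := by
  linarith [piQ_add_refl hq d]

lemma Tame.refl {q : ℝ} {d : Digits M} (h : Tame q d) : Tame q (refl d) := by
  refine ⟨fun n hn => ?_, fun n hn => ?_⟩
  · rw [shift_refl]
    refine h.2 n fun h0 => hn ?_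
    rw [refl_apply, h0, Fin.rev_zero]
  · rw [shift_refl, refl_refl]
    refine h.1 n fun h0 => hn ?_
    rw [refl_apply, h0, Fin.rev_last]

lemma one_le_of_le {q : ℝ} (hq : 1 < q) (hqM : q ≤ M + 1) : 1 ≤ (M : ℝ) / (q - 1) := by
  rw [le_div_iff₀ (by linarith)]; linarith

lemma cast_add_one_le {a b : Fin (M + 1)} (h : a < b) : ((a : ℕ) : ℝ) + 1 ≤ (b : ℕ) := by
  exact_mod_cast h

lemma piQ_lt_of_lexLt {q : ℝ} (hq : 1 < q) {d e : Digits M}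
    (hd : ∀ n, d n ≠ 0 → piQ M q (Expansions.refl (shift (n + 1) d)) < 1) (h : lexLt e d) :
    piQ M q e < piQ M q d := by
  obtain ⟨n, hn, hlt⟩ := h
  have h0 : (0 : ℝ) < q := by linarith
  have h1 := hd n (fun h0 => by rw [h0] at hlt; exact absurd hlt (Fin.not_lt_zero _))
  rw [piQ_refl hq] at h1
  have h2 := piQ_le hq (shift (n + 1) e)
  have h3 := cast_add_one_le hlt
  have h4 := piQ_sub_of_agree_succ hq hn
  rw [← sub_neg, h4]
  exact div_neg_of_neg_of_pos (by linarith) (by positivity)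

lemma Tame.mem_UqSym {q : ℝ} (hq : 1 < q) {d : Digits M} (h : Tame q d) : d ∈ UqSym M q := by
  intro e he
  rcases lexLt_trichotomy e d with h1 | h1 | h1
  · exact absurd he (piQ_lt_of_lexLt hq h.2 h1).ne
  · exact h1
  · have h2 : lexLt (Expansions.refl e) (Expansions.refl d) := by
      obtain ⟨n, hn, hlt⟩ := h1
      exact ⟨n, fun i hi => by simp [hn i hi], by simpa using hlt⟩
    have := piQ_lt_of_lexLt hq h.refl.2 h2
    rw [piQ_refl hq, piQ_refl hq] at this
    linarith

lemma refl_mem_UqSym {q : ℝ} (hq : 1 < q) {d : Digits M} (h : d ∈ UqSym M q) :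
    refl d ∈ UqSym M q := by
  intro e he
  rw [piQ_refl hq] at he
  have := h (refl e) (by rw [piQ_refl hq]; linarith)
  rw [← this, refl_refl]

lemma tail_lt_one_of_mem_UqSym {q : ℝ} (hq : 1 < q) (hqM : q ≤ M + 1) {d : Digits M}
    (h : d ∈ UqSym M q) (n : ℕ) (hn : d n ≠ Fin.last M) : piQ M q (shift (n + 1) d) < 1 := by
  by_contra hcon
  push Not at hcon
  obtain ⟨e', he'⟩ := exists_expansion hq hqM (x := piQ M q (shift (n + 1) d) - 1)
    ⟨by linarith, by linarith [piQ_le hq (shift (n + 1) d)]⟩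
  have hlt : (d n : ℕ) < M := by
    have := (d n).isLt
    have h2 : (d n : ℕ) ≠ M := fun h => hn (Fin.ext h)
    omega
  let e := prep (n + 1) (Function.update d n ⟨d n + 1, by omega⟩) e'
  have hag : ∀ i < n, e i = d i := fun i hi => by
    simp only [e, prep]
    rw [if_pos (by omega), Function.update_of_ne (by omega)]
  have hen : e n = ⟨d n + 1, by omega⟩ := by simp [e, prep]
  have h1 := piQ_sub_of_agree_succ hq hag
  rw [shift_prep_self, he', hen] at h1
  have h2 : e = d := h e (by rw [← sub_eq_zero, h1]; push_cast; ring_nf)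
  have h3 := congrArg (fun f : Digits M => (f n : ℕ)) h2
  simp [hen] at h3

lemma tame_of_mem_UqSym {q : ℝ} (hq : 1 < q) (hqM : q ≤ M + 1) {d : Digits M}
    (h : d ∈ UqSym M q) : Tame q d := by
  refine ⟨tail_lt_one_of_mem_UqSym hq hqM h, fun n hn => ?_⟩
  rw [← shift_refl]
  refine tail_lt_one_of_mem_UqSym hq hqM (refl_mem_UqSym hq h) n fun h0 => hn ?_
  rw [refl_apply, Fin.rev_eq_iff, Fin.rev_last] at h0
  exact h0

lemma Tame.shift_lt_one {q : ℝ} (hq : 1 < q) (hqM : q ≤ M + 1) {d : Digits M} (h : Tame q d)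
    {n : ℕ} (hn : piQ M q (shift n d) < 1) {m : ℕ} (hm : n ≤ m) : piQ M q (shift m d) < 1 := by
  induction m, hm using Nat.le_induction with
  | base => exact hn
  | succ m hm ih =>
    by_cases hl : d m = Fin.last M
    · rw [piQ_shift_succ hq, hl, div_lt_one (by linarith), Fin.val_last] at ih
      linarith
    · exact h.1 m hl

lemma Tame.refl_shift_lt_one {q : ℝ} (hq : 1 < q) (hqM : q ≤ M + 1) {d : Digits M} (h : Tame q d)
    {n : ℕ} (hn : piQ M q (Expansions.refl (shift n d)) < 1) {m : ℕ} (hm : n ≤ m) :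
    piQ M q (Expansions.refl (shift m d)) < 1 := by
  rw [← shift_refl] at hn ⊢
  exact h.refl.shift_lt_one hq hqM hn hm

lemma not_endsInZero_of_mem_UqSym {q : ℝ} (hq : 1 < q) (hqM : q ≤ M + 1) {d : Digits M}
    (h : d ∈ UqSym M q) (hpos : 0 < piQ M q d) : ¬ EndsInZero d := by
  rintro ⟨N, hN⟩
  have hT := tame_of_mem_UqSym hq hqM h
  induction N with
  | zero =>
    have : d = fun _ => 0 := funext fun n => hN n (Nat.zero_le n)
    rw [this] at hpos
    simp [piQ] at hpos
  | succ N ih =>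
    refine ih fun n hn => ?_
    rcases hn.lt_or_eq with h1 | rfl
    · exact hN n h1
    by_contra h0
    have h1 := hT.2 N h0
    have h2 : refl (shift (N + 1) d) = fun _ => Fin.last M := funext fun i => by
      rw [refl_apply, shift_apply, hN _ (by omega), Fin.rev_zero]
    rw [h2, piQ_last hq] at h1
    linarith [one_le_of_le hq hqM]

lemma mem_UxSym_iff {x : ℝ} (hx : 0 < x) (d : Digits M) :
    d ∈ UxSym M x ↔ ∃ q ∈ Set.Ioc (1 : ℝ) (M + 1), piQ M q d = x ∧ d ∈ UqSym M q := by
  have key : ∀ q ∈ Set.Ioc (1 : ℝ) (M + 1), ∀ e : Digits M, piQ M q e = x → e ∈ UqSym M q →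
      Phi M x q = e := by
    intro q hq e he hu
    have hex : ∃ d : Digits M, IsQuasiGreedy M q x d :=
      ⟨e, he, not_endsInZero_of_mem_UqSym hq.1 hq.2 hu (by rw [he]; exact hx),
        fun f hf _ => Or.inl (hu f (hf.trans he.symm))⟩
    rw [Phi, dif_pos hex]
    exact hu _ (hex.choose_spec.1.trans he.symm)
  constructor
  · rintro ⟨q, ⟨hq, e, he, hu⟩, rfl⟩
    have hu' : e ∈ UqSym M q := fun f hf => hu f (hf.trans he)
    rw [key q hq e he hu']
    exact ⟨q, hq, he, hu'⟩
  · rintro ⟨q, hq, he, hu⟩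
    exact ⟨q, ⟨hq, d, he, fun f hf => hu f (hf.trans he.symm)⟩, key q hq d he hu⟩

lemma mem_Ubases_iff {x q : ℝ} :
    q ∈ Ubases M x ↔ q ∈ Set.Ioc (1 : ℝ) (M + 1) ∧ ∃ d : Digits M, piQ M q d = x ∧ Tame q d := by
  constructor
  · rintro ⟨hq, e, he, hu⟩
    exact ⟨hq, e, he, tame_of_mem_UqSym hq.1 hq.2 fun f hf => hu f (hf.trans he)⟩
  · rintro ⟨hq, e, he, hu⟩
    exact ⟨hq, e, he, fun f hf => hu.mem_UqSym hq.1 f (hf.trans he.symm)⟩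

/-- Parry's argument: lexicographic bounds by an expansion of a number at most `1` give value
bounds. -/
lemma piQ_shift_lt_one_of_lexLt {q : ℝ} (hq : 1 < q) {a d : Digits M}
    (ha : piQ M q a ≤ 1) (hapos : ∀ j, 0 < piQ M q (shift j a))
    (h : ∀ n, lexLt (shift n d) a ∨ piQ M q (shift n d) < 1) (n : ℕ) :
    piQ M q (shift n d) < 1 := by
  have h0 : (0 : ℝ) < q := by linarith
  have step : ∀ n, piQ M q (shift n d) < 1 ∨ ∃ m j, piQ M q (shift n d) <
      1 + (piQ M q (shift m d) - 1) / q ^ (j + 1) := by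
    intro n
    rcases h n with ⟨j, hj, hlt⟩ | h
    · refine Or.inr ⟨n + (j + 1), j, ?_⟩
      have h1 := piQ_sub_of_agree_succ hq hj
      have h2 := cast_add_one_le hlt
      have h3 := hapos (j + 1)
      rw [shift_shift] at h1
      have h4 : piQ M q (shift n d) - piQ M q a <
          (piQ M q (shift (n + (j + 1)) d) - 1) / q ^ (j + 1) := by
        rw [h1]
        exact div_lt_div_of_pos_right (by linarith) (by positivity)
      linarith
    · exact Or.inl h
  have hK : ∀ t n, piQ M q (shift n d) - 1 ≤ (M / (q - 1)) / q ^ t := by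
    intro t
    induction t with
    | zero => intro n; simp only [pow_zero, div_one]; linarith [piQ_le hq (shift n d)]
    | succ t ih =>
      intro n
      have hnn : (0 : ℝ) ≤ M / (q - 1) := div_nonneg (Nat.cast_nonneg _) (by linarith)
      rcases step n with h | ⟨m, j, h⟩
      · have : 0 ≤ (M / (q - 1)) / q ^ (t + 1) := by positivity
        linarith
      · have h1 : (piQ M q (shift m d) - 1) / q ^ (j + 1) ≤ ((M / (q - 1)) / q ^ t) / q ^ (j + 1) := by
          gcongr
          exact ih m
        have h2 : ((M / (q - 1)) / q ^ t) / q ^ (j + 1) ≤ ((M / (q - 1)) / q ^ t) / q ^ 1 := by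
          gcongr
          · exact hq.le
          · omega
        rw [pow_one, div_div _ (q ^ t) q, ← pow_succ] at h2
        linarith
  have hle : ∀ n, piQ M q (shift n d) ≤ 1 := by
    intro n
    have h3 : Filter.Tendsto (fun t : ℕ => (M / (q - 1)) / q ^ t) Filter.atTop (nhds 0) :=
      tendsto_const_nhds.div_atTop (tendsto_pow_atTop_atTop_of_one_lt hq)
    have := ge_of_tendsto' h3 (fun t => hK t n)
    linarith
  rcases step n with h | ⟨m, j, h⟩
  · exact h
  · have : (piQ M q (shift m d) - 1) / q ^ (j + 1) ≤ 0 :=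
      div_nonpos_of_nonpos_of_nonneg (by linarith [hle m]) (by positivity)
    linarith

/-- The Thue–Morse sequence as a Boolean sequence. -/
def par (i : ℕ) : Bool := (Nat.digits 2 i).sum.bodd

lemma par_two_mul (i : ℕ) : par (2 * i) = par i := by
  rcases Nat.eq_zero_or_pos i with rfl | h
  · rfl
  · rw [par, Nat.digits_def' (by norm_num) (by omega)]
    simp [par]

lemma par_two_mul_add_one (i : ℕ) : par (2 * i + 1) = !par i := by
  have h : Nat.digits 2 (2 * i + 1) = 1 :: Nat.digits 2 i := by
    rw [Nat.digits_def' (by norm_num) (by omega)]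
    congr 1
    · omega
    · congr 1; omega
  rw [par, h]
  simp [par, Nat.bodd_add]

lemma par_zero : par 0 = false := rfl

lemma par_one : par 1 = true := by simpa [par_zero] using par_two_mul_add_one 0

lemma par_two : par 2 = true := by simpa [par_one] using par_two_mul 1

lemma par_pow_mul_add (k j r : ℕ) (hr : r < 2 ^ k) :
    par (2 ^ k * j + r) = xor (par j) (par r) := by
  induction k generalizing r with
  | zero =>
    have : r = 0 := by simpa using hr
    subst this
    simp [par_zero]
  | succ k ih =>
    obtain ⟨s, rfl | rfl⟩ := Nat.even_or_odd' r
    · have h := ih s (by rw [pow_succ] at hr; omega)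
      rw [show 2 ^ (k + 1) * j + 2 * s = 2 * (2 ^ k * j + s) by ring, par_two_mul, par_two_mul, h]
    · have h := ih s (by rw [pow_succ] at hr; omega)
      rw [show 2 ^ (k + 1) * j + (2 * s + 1) = 2 * (2 ^ k * j + s) + 1 by ring,
        par_two_mul_add_one, par_two_mul_add_one, h]
      simp

lemma par_pow (k : ℕ) : par (2 ^ k) = true := by
  have := par_pow_mul_add k 1 0 (by positivity)
  simpa [par_one, par_zero] using this

lemma par_pow_add (k r : ℕ) (hr : r < 2 ^ k) : par (2 ^ k + r) = !par r := by
  have := par_pow_mul_add k 1 r hr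
  simpa [par_one] using this

/-- Normalized to start with `0`, every proper shift of the Thue–Morse sequence is
lexicographically smaller than the sequence itself. -/
lemma par_shift_lt (i : ℕ) (hi : 0 < i) : ∃ j, (∀ l < j, xor (par (i + l)) (par i) = par l) ∧
    xor (par (i + j)) (par i) = false ∧ par j = true := by
  induction i using Nat.strong_induction_on with
  | _ i ih =>
    obtain ⟨a, rfl | rfl⟩ := Nat.even_or_odd' i
    · obtain ⟨j, h1, h2, h3⟩ := ih a (by omega) (by omega)
      refine ⟨2 * j, fun l hl => ?_, ?_, by rw [par_two_mul, h3]⟩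
      · obtain ⟨s, rfl | rfl⟩ := Nat.even_or_odd' l
        · rw [← mul_add, par_two_mul, par_two_mul, par_two_mul, h1 s (by omega)]
        · rw [← add_assoc, ← mul_add, par_two_mul_add_one, par_two_mul, par_two_mul_add_one,
            ← h1 s (by omega)]
          simp
      · rw [← mul_add, par_two_mul, par_two_mul, h2]
    · have e1 : par (2 * a + 1 + 1) = par (a + 1) := by
        rw [show 2 * a + 1 + 1 = 2 * (a + 1) by ring, par_two_mul]
      have e2 : par (2 * a + 1 + 2) = !par (a + 1) := by
        rw [show 2 * a + 1 + 2 = 2 * (a + 1) + 1 by ring, par_two_mul_add_one]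
      have e0 := par_two_mul_add_one a
      by_cases hb : xor (par (a + 1)) (par (2 * a + 1)) = false
      · refine ⟨1, fun l hl => ?_, by rw [e1, hb], par_one⟩
        have : l = 0 := by omega
        subst this
        simp [par_zero]
      · refine ⟨2, fun l hl => ?_, ?_, par_two⟩
        · have : l = 0 ∨ l = 1 := by omega
          rcases this with rfl | rfl
          · simp [par_zero]
          · rw [e1, par_one]; simpa using hb
        · rw [e2]; revert hb
          cases par (a + 1) <;> cases par (2 * a + 1) <;> simp

lemma par_not_three (i : ℕ) (h : par i = par (i + 1)) : par (i + 2) = !par (i + 1) := by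
  obtain ⟨a, rfl | rfl⟩ := Nat.even_or_odd' i
  · rw [par_two_mul, par_two_mul_add_one] at h
    cases hp : par a <;> simp [hp] at h
  · rw [show 2 * a + 1 + 2 = 2 * (a + 1) + 1 by ring, show 2 * a + 1 + 1 = 2 * (a + 1) by ring,
      par_two_mul_add_one, par_two_mul]

/-- The digit sequence over `{0, …, M}` coded by a Boolean sequence `t`: digits are
`(M - 1) / 2 + t_{i+1}` for odd `M` and `M / 2 + t_{i+1} - t_i` for even `M`. -/
def code (M : ℕ) (t : ℕ → Bool) : Digits M := fun i =>
  Fin.ofNat (M + 1) (M / 2 + (t (i + 1)).toNat - if M % 2 = 0 then (t i).toNat else 0)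

lemma code_val (hM : 0 < M) (t : ℕ → Bool) (i : ℕ) :
    (code M t i : ℕ) + (if M % 2 = 0 then (t i).toNat else 0) = M / 2 + (t (i + 1)).toNat := by
  have h1 := Bool.toNat_le (t i)
  have h2 := Bool.toNat_le (t (i + 1))
  simp only [code, Fin.val_ofNat]
  rw [Nat.mod_eq_of_lt]
  · split_ifs <;> omega
  · split_ifs <;> omega

lemma shift_code (n : ℕ) (t : ℕ → Bool) : shift n (code M t) = code M fun i => t (n + i) := rfl

lemma refl_code (hM : 0 < M) (t : ℕ → Bool) : refl (code M t) = code M fun i => !t i := by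
  funext i
  apply Fin.ext
  have h1 := code_val hM t i
  have h2 := code_val hM (fun i => !t i) i
  have h3 := val_rev_add (code M t i)
  rw [refl_apply]
  cases hp : t i <;> cases hp' : t (i + 1) <;>
    simp only [hp, hp', Bool.toNat_true, Bool.toNat_false, Bool.not_true, Bool.not_false]
      at h1 h2 <;>
    split_ifs at h1 h2 <;> omega

lemma code_congr {t s : ℕ → Bool} {n : ℕ} (h : ∀ l ≤ n, t l = s l) (i : ℕ) (hi : i < n) :
    code M t i = code M s i := by
  simp only [code]
  rw [h i (by omega), h (i + 1) (by omega)]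

/-- The generalized Thue–Morse digit sequence, the expansion of `1` in the Komornik–Loreti base. -/
def lam (M : ℕ) : Digits M := code M par

lemma shift_code_lexLt_lam (hM : 0 < M) (c : Bool) (i : ℕ) (hi : 0 < i ∨ c = true) :
    lexLt (shift i (code M fun l => xor c (par l))) (lam M) := by
  rw [shift_code]
  by_cases h0 : xor c (par i) = false
  · have hi : 0 < i := by
      rcases hi with h | rfl
      · exact h
      · rcases Nat.eq_zero_or_pos i with rfl | h
        · simp [par_zero] at h0
        · exact h
    have hc : c = par i := by simpa using h0
    obtain ⟨j, h1, h2, h3⟩ := par_shift_lt i hi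
    have h1' : ∀ l < j, xor c (par (i + l)) = par l := fun l hl => by
      rw [hc, Bool.xor_comm]; exact h1 l hl
    have h2' : xor c (par (i + j)) = false := by
      rw [hc, Bool.xor_comm]; exact h2
    have hj : j ≠ 0 := by
      rintro rfl
      rw [par_zero] at h3; exact absurd h3 (by simp)
    obtain ⟨j, rfl⟩ := Nat.exists_eq_succ_of_ne_zero hj
    refine ⟨j, fun l hl => code_congr (n := j) (fun l hl => h1' l (by omega)) l hl, ?_⟩
    have e1 := code_val hM (fun l => xor c (par (i + l))) j
    have e2 := code_val hM par j
    rw [Fin.lt_def]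
    simp only [h1' j (by omega)] at e1
    simp only [Nat.succ_eq_add_one] at h2' h3
    rw [h2'] at e1
    rw [h3] at e2
    simp only [Bool.toNat_true, Bool.toNat_false] at e1 e2
    simp only [lam]
    omega
  · have h0' : xor c (par i) = true := by simpa using h0
    have e1 := code_val hM (fun l => xor c (par (i + l))) 0
    have e2 := code_val hM par 0
    simp only [add_zero, zero_add, h0', par_zero, par_one, Bool.toNat_true, Bool.toNat_false] at e1 e2
    by_cases hM2 : M % 2 = 0
    · refine ⟨0, fun l hl => absurd hl (Nat.not_lt_zero l), ?_⟩
      rw [Fin.lt_def]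
      simp only [hM2, if_true] at e1 e2
      have := Bool.toNat_le (xor c (par (i + 1)))
      simp only [lam]
      omega
    · simp only [hM2, if_false] at e1 e2
      by_cases hb : xor c (par (i + 1)) = false
      · refine ⟨0, fun l hl => absurd hl (Nat.not_lt_zero l), ?_⟩
        rw [Fin.lt_def]
        rw [hb, Bool.toNat_false] at e1
        simp only [lam]
        omega
      · have hb' : xor c (par (i + 1)) = true := by simpa using hb
        have hb2 : xor c (par (i + 2)) = false := by
          have h3 : par i = par (i + 1) := by
            have := h0'.trans hb'.symm
            simpa using this
          rw [par_not_three i h3]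
          revert hb'
          cases c <;> cases par (i + 1) <;> simp
        refine ⟨1, fun l hl => ?_, ?_⟩
        · have : l = 0 := by omega
          subst this
          apply Fin.ext
          rw [hb', Bool.toNat_true] at e1
          simp only [lam]
          omega
        · have e3 := code_val hM (fun l => xor c (par (i + l))) 1
          have e4 := code_val hM par 1
          simp only [hM2, if_false, Nat.reduceAdd, hb2, par_two, Bool.toNat_true,
            Bool.toNat_false] at e3 e4
          rw [Fin.lt_def]
          simp only [lam]
          omega

lemma shift_lam_lexLt (hM : 0 < M) (i : ℕ) (hi : 0 < i) : lexLt (shift i (lam M)) (lam M) := by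
  simpa [lam] using shift_code_lexLt_lam hM false i (Or.inl hi)

lemma refl_shift_lam_lexLt (hM : 0 < M) (i : ℕ) : lexLt (refl (shift i (lam M))) (lam M) := by
  have := shift_code_lexLt_lam hM true i (Or.inr rfl)
  simp only [Bool.true_xor] at this
  rwa [← refl_code hM, shift_refl] at this

lemma lam_zero (hM : 0 < M) : (lam M 0 : ℕ) = M / 2 + 1 := by
  have := code_val hM par 0
  simpa [par_zero, par_one, lam] using this

/-- The periodic sequences `(w w̄)^∞`, where `w` is the prefix of `lam` of length `2 ^ n`. -/
def theta (M n : ℕ) : Digits M := fun i =>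
  if (i / 2 ^ n) % 2 = 0 then lam M (i % 2 ^ n) else (lam M (i % 2 ^ n)).rev

lemma theta_add (n i : ℕ) : theta M n (2 ^ n + i) = (theta M n i).rev := by
  have h1 : (2 ^ n + i) / 2 ^ n = i / 2 ^ n + 1 := by
    rw [Nat.add_div_left _ (by positivity)]
  have h2 : (2 ^ n + i) % 2 ^ n = i % 2 ^ n := by simp
  simp only [theta, h1, h2]
  by_cases h : (i / 2 ^ n) % 2 = 0
  · rw [if_pos h, if_neg (by omega)]
  · rw [if_neg h, if_pos (by omega), Fin.rev_rev]

lemma theta_of_lt {n i : ℕ} (hi : i < 2 ^ n) : theta M n i = lam M i := by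
  simp [theta, Nat.div_eq_of_lt hi, Nat.mod_eq_of_lt hi]

lemma shift_theta (n : ℕ) : shift (2 ^ n) (theta M n) = refl (theta M n) :=
  funext fun i => theta_add n i

lemma shift_theta_period (n : ℕ) : shift (2 ^ (n + 1)) (theta M n) = theta M n := by
  rw [pow_succ, mul_two, ← shift_shift, shift_theta, shift_refl, shift_theta, refl_refl]

lemma theta_eq_lam (hM : 0 < M) {n i : ℕ} (hi : i + 1 < 2 ^ (n + 1)) :
    theta M n i = lam M i := by
  rcases lt_or_ge i (2 ^ n) with h | h
  · exact theta_of_lt h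
  obtain ⟨r, rfl⟩ := Nat.exists_eq_add_of_le h
  have hr : r + 1 < 2 ^ n := by rw [pow_succ] at hi; omega
  rw [theta_add, theta_of_lt (by omega)]
  apply Fin.ext
  have e1 := code_val hM par r
  have e2 := code_val hM par (2 ^ n + r)
  have e3 := val_rev_add (lam M r)
  rw [add_assoc, par_pow_add n r (by omega), par_pow_add n (r + 1) hr] at e2
  simp only [lam] at e3 ⊢
  cases hp : par r <;> cases hp' : par (r + 1) <;>
  simp only [hp, hp', Bool.toNat_true, Bool.toNat_false, Bool.not_true, Bool.not_false] at e1 e2 <;>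
  split_ifs at e1 e2 <;> omega

lemma theta_last_add_one (hM : 0 < M) {n i : ℕ} (hi : i + 1 = 2 ^ (n + 1)) :
    (theta M n i : ℕ) + 1 = lam M i := by
  have h : 2 ^ n ≤ i := by
    rw [pow_succ] at hi
    have : 0 < 2 ^ n := by positivity
    omega
  obtain ⟨r, rfl⟩ := Nat.exists_eq_add_of_le h
  have hr : r + 1 = 2 ^ n := by rw [pow_succ] at hi; omega
  rw [theta_add, theta_of_lt (by omega)]
  have e1 := code_val hM par r
  have e2 := code_val hM par (2 ^ n + r)
  have e3 := val_rev_add (lam M r)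
  rw [hi, par_pow_add n r (by omega), par_pow] at e2
  rw [hr, par_pow] at e1
  simp only [lam] at e3 ⊢
  cases hp : par r <;>
  simp only [hp, Bool.toNat_true, Bool.toNat_false, Bool.not_true, Bool.not_false] at e1 e2 <;>
  split_ifs at e1 e2 <;> omega

lemma lexLt_asymm {c d : Digits M} (h1 : lexLt c d) (h2 : lexLt d c) : False := by
  obtain ⟨n, hn, hlt⟩ := h1
  obtain ⟨m, hm, hlt'⟩ := h2
  rcases lt_trichotomy n m with h | rfl | h
  · rw [hm n h] at hlt; exact lt_irrefl _ hlt
  · exact lt_asymm hlt hlt'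
  · rw [hn m h] at hlt'; exact lt_irrefl _ hlt'

lemma lexLt_refl_refl {c d : Digits M} (h : lexLt c d) : lexLt (refl d) (refl c) := by
  obtain ⟨n, hn, hlt⟩ := h
  exact ⟨n, fun i hi => by simp [hn i hi], by simpa using hlt⟩

/-- All shifts of `d` are lexicographically strictly between the reflection of `a` and `a`. -/
def StrictBetween (a d : Digits M) : Prop :=
  ∀ i, lexLt (shift i d) a ∧ lexLt (refl (shift i d)) a

/-- All shifts of `d` are lexicographically between the reflection of `a` and `a`. -/
def WeakBetween (a d : Digits M) : Prop :=
  ∀ i, lexLe (shift i d) a ∧ lexLe (refl (shift i d)) a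

lemma StrictBetween.refl {a d : Digits M} (h : StrictBetween a d) :
    StrictBetween a (Expansions.refl d) := fun i => by
  rw [shift_refl, refl_refl]
  exact ⟨(h i).2, (h i).1⟩

lemma StrictBetween.exists_lt_lam {n : ℕ} {d : Digits M} (h : StrictBetween (theta M n) d) (i : ℕ) :
    ∃ k < 2 ^ n, (∀ l < k, d (i + l) = lam M l) ∧ d (i + k) < lam M k := by
  obtain ⟨k, hk, hlt⟩ := (h i).1
  rcases lt_or_ge k (2 ^ n) with hkn | hkn
  · refine ⟨k, hkn, fun l hl => ?_, ?_⟩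
    · rw [← theta_of_lt (hl.trans hkn)]; exact hk l hl
    · rw [← theta_of_lt hkn]; exact hlt
  · exfalso
    obtain ⟨r, rfl⟩ := Nat.exists_eq_add_of_le hkn
    have h1 : lexLt (shift (i + 2 ^ n) d) (Expansions.refl (theta M n)) := by
      refine ⟨r, fun l hl => ?_, ?_⟩
      · have := hk (2 ^ n + l) (by omega)
        rw [theta_add, shift_apply, ← add_assoc] at this
        exact this
      · rw [theta_add, shift_apply, ← add_assoc] at hlt
        exact hlt
    have h2 := lexLt_refl_refl h1
    rw [refl_refl] at h2
    exact lexLt_asymm h2 (h _).2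

lemma lexLe_theta_of_exists_lt_lam (hM : 0 < M) {n : ℕ} {d : Digits M}
    (h : ∀ i, ∃ k < 2 ^ (n + 1), (∀ l < k, d (i + l) = lam M l) ∧ d (i + k) < lam M k) (i : ℕ) :
    lexLe (shift i d) (theta M n) := by
  have key : ∀ m i, (∀ l < m, theta M n l = d (i + l)) → ¬ theta M n m < d (i + m) := by
    intro m
    induction m using Nat.strong_induction_on with
    | _ m ih =>
      intro i hag hlt
      obtain ⟨k, hk, hkl, hklt⟩ := h i
      by_cases hk1 : k + 1 < 2 ^ (n + 1)
      · rcases lt_trichotomy m k with hmk | rfl | hmk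
        · rw [hkl m hmk, theta_eq_lam hM (by omega)] at hlt
          exact lt_irrefl _ hlt
        · rw [theta_eq_lam hM hk1] at hlt
          exact lt_asymm hlt hklt
        · have := hag k hmk
          rw [theta_eq_lam hM hk1] at this
          rw [this] at hklt
          exact lt_irrefl _ hklt
      · have hk2 : k + 1 = 2 ^ (n + 1) := by omega
        rcases lt_trichotomy m k with hmk | rfl | hmk
        · rw [hkl m hmk, theta_eq_lam hM (by omega)] at hlt
          exact lt_irrefl _ hlt
        · have := theta_last_add_one hM hk2
          rw [Fin.lt_def] at hlt hklt
          omega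
        · obtain ⟨r, rfl⟩ := Nat.exists_eq_add_of_le (show 2 ^ (n + 1) ≤ m by omega)
          have hp : ∀ l, theta M n (2 ^ (n + 1) + l) = theta M n l := fun l =>
            congrFun (shift_theta_period (M := M) n) l
          refine ih r (by omega) (i + 2 ^ (n + 1)) (fun l hl => ?_) ?_
          · rw [add_assoc, ← hp l]; exact hag _ (by omega)
          · rw [add_assoc, ← hp r]; exact hlt
  rcases lexLt_trichotomy (shift i d) (theta M n) with h1 | h1 | ⟨m, hm, hlt⟩
  · exact Or.inr h1
  · exact Or.inl h1
  · exact absurd hlt (key m i hm)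

lemma StrictBetween.weakBetween (hM : 0 < M) {n : ℕ} {d : Digits M}
    (h : StrictBetween (theta M (n + 1)) d) : WeakBetween (theta M n) d := fun i =>
  ⟨lexLe_theta_of_exists_lt_lam hM h.exists_lt_lam i, by
    rw [← shift_refl]; exact lexLe_theta_of_exists_lt_lam hM h.refl.exists_lt_lam i⟩

/-- Sequences lying strictly between `theta M n` and its reflection are eventually equal to some
`theta M j` up to reflection, or constant. -/
lemma StrictBetween.eventually (hM : 0 < M) {n : ℕ} {d : Digits M}
    (h : StrictBetween (theta M n) d) :
    (∃ j i, WeakBetween (theta M j) d ∧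
      (shift i d = theta M j ∨ Expansions.refl (shift i d) = theta M j)) ∨ ∀ i, d i = d 0 := by
  induction n with
  | zero =>
    right
    have h1 : ∀ i, 2 * (d i : ℕ) = M := by
      intro i
      have e0 := lam_zero hM
      obtain ⟨k, hk, -, h3⟩ := h.exists_lt_lam i
      obtain ⟨k', hk', -, h4⟩ := h.refl.exists_lt_lam i
      obtain rfl : k = 0 := by simpa using hk
      obtain rfl : k' = 0 := by simpa using hk'
      rw [Fin.lt_def] at h3 h4
      rw [refl_apply] at h4
      have h5 := val_rev_add (d (i + 0))
      simp only [add_zero] at h3 h4 h5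
      omega
    intro i
    apply Fin.ext
    have := h1 i
    have := h1 0
    omega
  | succ n ih =>
    have hw := h.weakBetween hM
    by_cases hex : ∃ i, shift i d = theta M n ∨ Expansions.refl (shift i d) = theta M n
    · obtain ⟨i, hi⟩ := hex
      exact Or.inl ⟨n, i, hw, hi⟩
    · push Not at hex
      exact ih fun i => ⟨(hw i).1.resolve_left (hex i).1, (hw i).2.resolve_left (hex i).2⟩

lemma Tame.shift {q : ℝ} {d : Digits M} (h : Tame q d) (i : ℕ) : Tame q (Expansions.shift i d) := by
  refine ⟨fun n hn => ?_, fun n hn => ?_⟩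
  · rw [shift_shift]; exact h.1 _ hn
  · rw [shift_shift]; exact h.2 _ hn

lemma exists_lam_ne_zero (hM : 0 < M) (j : ℕ) : ∃ i, shift j (lam M) i ≠ 0 := by
  obtain ⟨n, -, hlt⟩ := refl_shift_lam_lexLt hM j
  refine ⟨n, fun h0 => ?_⟩
  rw [refl_apply, h0, Fin.rev_zero] at hlt
  exact absurd hlt (not_lt.2 (Fin.le_last _))

lemma piQ_shift_lam_pos (hM : 0 < M) {q : ℝ} (hq : 1 < q) (j : ℕ) :
    0 < piQ M q (shift j (lam M)) := by
  obtain ⟨i, hi⟩ := exists_lam_ne_zero hM j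
  exact piQ_pos hq hi

lemma one_lt_cast_add_one (hM : 0 < M) : (1 : ℝ) < M + 1 := by
  have : (0 : ℝ) < M := by exact_mod_cast hM
  linarith

lemma piQ_lam_integer_base_lt_one (hM : 0 < M) : piQ M (M + 1) (lam M) < 1 := by
  have h1 := one_lt_cast_add_one hM
  obtain ⟨n, -, hlt⟩ := shift_lam_lexLt hM 1 one_pos
  have h2 : refl (lam M) (1 + n) ≠ 0 := by
    rw [refl_apply, Ne, Fin.rev_eq_iff, Fin.rev_zero]
    rintro h
    rw [shift_apply, h] at hlt
    exact absurd hlt (not_lt.2 (Fin.le_last _))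
  have h3 := piQ_pos h1 h2
  rw [piQ_refl h1, add_sub_cancel_right, div_self (by linarith)] at h3
  linarith

lemma one_lt_piQ_lam (hM : 0 < M) : 1 < piQ M (3 / 2) (lam M) := by
  have hq : (1 : ℝ) < 3 / 2 := by norm_num
  have h1 := piQ_eq_prefix hq (lam M) 2
  have h2 := piQ_nonneg hq (shift 2 (lam M))
  have h3 : 1 ≤ (lam M 0 : ℕ) := by rw [lam_zero hM]; omega
  have h4 : 1 ≤ (lam M 1 : ℕ) := by
    have := code_val hM par 1
    simp only [Nat.reduceAdd, par_one, par_two, Bool.toNat_true] at this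
    simp only [lam]
    split_ifs at this <;> omega
  have h3' : (1 : ℝ) ≤ (lam M 0 : ℕ) := by exact_mod_cast h3
  have h4' : (1 : ℝ) ≤ (lam M 1 : ℕ) := by exact_mod_cast h4
  rw [h1, Finset.sum_range_succ, Finset.sum_range_one]
  norm_num
  have : 0 ≤ piQ M (3 / 2) (shift 2 (lam M)) / (9 / 4) := by positivity
  linarith

lemma three_halves_le_of_piQ_lam_le_one (hM : 0 < M) {q : ℝ} (hq : 1 < q)
    (h : piQ M q (lam M) ≤ 1) : 3 / 2 ≤ q := by
  by_contra hcon
  push Not at hcon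
  linarith [piQ_antitone hq hcon.le (lam M), one_lt_piQ_lam hM]

lemma tame_lam (hM : 0 < M) {r : ℝ} (hr : 1 < r) (h : piQ M r (lam M) = 1) : Tame r (lam M) := by
  refine ⟨fun n _ => ?_, fun n _ => ?_⟩
  · have := piQ_shift_lt_one_of_lexLt hr (a := lam M) (d := shift 1 (lam M)) h.le
      (piQ_shift_lam_pos hM hr)
      (fun n => Or.inl (by rw [shift_shift]; exact shift_lam_lexLt hM _ (by omega))) n
    rwa [shift_shift, add_comm] at this
  · have := piQ_shift_lt_one_of_lexLt hr (a := lam M) (d := refl (lam M)) h.le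
      (piQ_shift_lam_pos hM hr)
      (fun n => Or.inl (by rw [shift_refl]; exact refl_shift_lam_lexLt hM _)) (n + 1)
    rwa [shift_refl] at this

lemma exists_univoque_base_le (hM : 0 < M) {q : ℝ} (hq : q ∈ Set.Ioc (1 : ℝ) (M + 1))
    (h : piQ M q (lam M) ≤ 1) : ∃ r ≤ q, r ∈ Ubases M 1 ∧ piQ M r (lam M) = 1 := by
  obtain ⟨r, hr, h1⟩ := exists_base (by norm_num) (three_halves_le_of_piQ_lam_le_one hM hq.1 h)
    (lam M) h (one_lt_piQ_lam hM).le
  have hr1 : 1 < r := by linarith [hr.1]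
  exact ⟨r, hr.2, mem_Ubases_iff.2 ⟨⟨hr1, hr.2.trans hq.2⟩, lam M, h1, tame_lam hM hr1 h1⟩, h1⟩

lemma exists_theta_gt_one {q : ℝ} (hq : 1 < q) (h : 1 < piQ M q (lam M)) :
    ∃ n, 1 < piQ M q (theta M n) := by
  have h3 : Filter.Tendsto (fun n : ℕ => (M / (q - 1)) / q ^ 2 ^ n) Filter.atTop (nhds 0) :=
    (tendsto_const_nhds.div_atTop (tendsto_pow_atTop_atTop_of_one_lt hq)).comp
      (tendsto_pow_atTop_atTop_of_one_lt (one_lt_two))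
  obtain ⟨n, hn⟩ := (h3.eventually (gt_mem_nhds (sub_pos.2 h))).exists
  refine ⟨n, ?_⟩
  have h1 := abs_piQ_sub_le hq (d := theta M n) (e := lam M) (n := 2 ^ n)
    (fun i hi => theta_of_lt hi)
  linarith [(abs_le.1 h1).1]

lemma Tame.strictBetween {q : ℝ} (hq : 1 < q) {a d : Digits M} (h : Tame q d)
    (ha : 1 < piQ M q a) (h1 : ∀ i, piQ M q (Expansions.shift i d) ≤ 1)
    (h2 : ∀ i, piQ M q (Expansions.refl (Expansions.shift i d)) ≤ 1) : StrictBetween a d := by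
  have key : ∀ e : Digits M, Tame q e → piQ M q e ≤ 1 → lexLt e a := by
    intro e he h1
    rcases lexLt_trichotomy e a with h | h | h
    · exact h
    · rw [h] at h1; linarith
    · have := piQ_lt_of_lexLt hq he.2 h
      linarith
  exact fun i => ⟨key _ (h.shift i) (h1 i), key _ (h.shift i).refl (h2 i)⟩

lemma piQ_lam_le_one_of_mem (hM : 0 < M) {r : ℝ} (h : r ∈ Ubases M 1) : piQ M r (lam M) ≤ 1 := by
  obtain ⟨⟨hr, hrM⟩, δ, hδ, hT⟩ := mem_Ubases_iff.1 h
  by_contra hcon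
  push Not at hcon
  have hrM' : r < M + 1 := lt_of_le_of_ne hrM fun h => by
    rw [h] at hcon
    linarith [piQ_lam_integer_base_lt_one hM]
  have e := piQ_succ hr δ
  rw [hδ, eq_div_iff (by linarith)] at e
  have h1 : piQ M r (shift 1 δ) < 1 := by
    by_cases hl : δ 0 = Fin.last M
    · rw [hl, Fin.val_last] at e; linarith
    · exact hT.1 0 hl
  have h0 : δ 0 ≠ 0 := by
    intro h0
    rw [h0, Fin.val_zero] at e
    norm_num at e
    linarith
  have h2 : piQ M r (refl (shift 1 δ)) < 1 := hT.2 0 h0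
  have h3 : piQ M r (refl δ) < 1 := by
    have := piQ_add_refl hr (shift 1 δ)
    rw [piQ_refl hr, hδ]; linarith
  have h1' : ∀ i, 0 < i → piQ M r (shift i δ) < 1 := fun i hi => hT.shift_lt_one hr hrM h1 hi
  have h2' : ∀ i, piQ M r (refl (shift i δ)) < 1 := fun i =>
    hT.refl_shift_lt_one hr hrM (n := 0) (by simpa using h3) (Nat.zero_le i)
  obtain ⟨n, hn⟩ := exists_theta_gt_one hr hcon
  have hS := hT.strictBetween hr hn
    (fun i => by
      rcases Nat.eq_zero_or_pos i with rfl | hi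
      · simp [hδ]
      · exact (h1' i hi).le)
    (fun i => (h2' i).le)
  have hle : ∀ a : Digits M, Tame r a → lexLe δ a → 1 ≤ piQ M r a := by
    intro a ha hla
    rcases hla with rfl | hla
    · exact hδ.ge
    · rw [← hδ]; exact (piQ_lt_of_lexLt hr ha.2 hla).le
  have hper : ∀ p, 0 < p → shift p δ ≠ δ := fun p hp hpe => by
    have := h1' p hp
    rw [hpe] at this
    linarith
  rcases hS.eventually hM with ⟨j, i, hw, hi⟩ | hc
  · have hw0 := (hw 0).1
    rw [shift_zero] at hw0
    rcases hi with hi | hi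
    · rw [← hi] at hw0
      have := hle _ (hT.shift i) hw0
      rcases Nat.eq_zero_or_pos i with rfl | hpos
      · rw [shift_zero] at hi
        exact hper (2 ^ (j + 1)) (by positivity) (by rw [hi, shift_theta_period])
      · linarith [h1' i hpos]
    · rw [← hi] at hw0
      have := hle _ (hT.shift i).refl hw0
      linarith [h2' i]
  · refine hper 1 one_pos (funext fun i => ?_)
    rw [shift_apply, hc, hc i]

lemma Tame.eventually_periodic (hM : 0 < M) {q : ℝ} (hq : 1 < q) (hqM : q ≤ M + 1)
    (hlam : 1 < piQ M q (lam M)) {d : Digits M} (h : Tame q d) :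
    ∃ i p, 0 < p ∧ Expansions.shift (i + p) d = Expansions.shift i d := by
  by_cases h1 : ∃ n, d n ≠ Fin.last M
  · by_cases h2 : ∃ n, d n ≠ 0
    · obtain ⟨a, ha⟩ := h1
      obtain ⟨b, hb⟩ := h2
      obtain ⟨n, hn⟩ := exists_theta_gt_one hq hlam
      have hS := (h.shift (a + b + 1)).strictBetween hq hn
        (fun i => by
          rw [shift_shift]; exact (h.shift_lt_one hq hqM (h.1 a ha) (by omega)).le)
        (fun i => by
          rw [shift_shift]; exact (h.refl_shift_lt_one hq hqM (h.2 b hb) (by omega)).le)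
      rcases hS.eventually hM with ⟨j, i, -, hi⟩ | hc
      · refine ⟨a + b + 1 + i, 2 ^ (j + 1), by positivity, ?_⟩
        rw [shift_shift] at hi
        rw [← shift_shift]
        rcases hi with hi | hi
        · rw [hi, shift_theta_period]
        · rw [← refl_refl (Expansions.shift (a + b + 1 + i) d), hi, shift_refl, shift_theta_period]
      · refine ⟨a + b + 1, 1, one_pos, ?_⟩
        rw [← shift_shift]
        funext i
        rw [shift_apply, hc, hc i]
    · push Not at h2
      exact ⟨0, 1, one_pos, funext fun i => by simp [h2]⟩
  · push Not at h1
    exact ⟨0, 1, one_pos, funext fun i => by simp [h1]⟩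

lemma exists_univoque_base_lt (hM : 0 < M) : ∃ r ∈ Ubases M 1, r < M + 1 := by
  have h := piQ_lam_integer_base_lt_one hM
  obtain ⟨r, hr, hr1, hr2⟩ :=
    exists_univoque_base_le hM ⟨one_lt_cast_add_one hM, le_refl _⟩ h.le
  refine ⟨r, hr1, lt_of_le_of_ne hr fun he => ?_⟩
  rw [he] at hr2
  linarith

lemma bddBelow_Ubases (x : ℝ) : BddBelow (Ubases M x) := ⟨1, fun _ hr => hr.1.1.le⟩

lemma one_lt_qKL (hM : 0 < M) : 1 < qKL M := by
  obtain ⟨r, hr, -⟩ := exists_univoque_base_lt hM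
  have : (3 : ℝ) / 2 ≤ qKL M := le_csInf ⟨r, hr⟩ fun s hs =>
    three_halves_le_of_piQ_lam_le_one hM hs.1.1 (piQ_lam_le_one_of_mem hM hs)
  linarith

lemma qKL_lt (hM : 0 < M) : qKL M < M + 1 := by
  obtain ⟨r, hr, h⟩ := exists_univoque_base_lt hM
  exact (csInf_le (bddBelow_Ubases 1) hr).trans_lt h

lemma one_lt_piQ_lam_of_lt_qKL (hM : 0 < M) {q : ℝ} (hq : 1 < q) (h : q < qKL M) :
    1 < piQ M q (lam M) := by
  by_contra hcon
  push Not at hcon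
  obtain ⟨r, hr, hr1, -⟩ := exists_univoque_base_le hM ⟨hq, (h.trans (qKL_lt hM)).le⟩ hcon
  linarith [csInf_le (bddBelow_Ubases 1) hr1, show qKL M = sInf (Ubases M 1) from rfl]

lemma piQ_lam_lt_one_of_qKL_lt (hM : 0 < M) {p : ℝ} (h : qKL M < p) : piQ M p (lam M) < 1 := by
  obtain ⟨r, hr, -⟩ := exists_univoque_base_lt hM
  obtain ⟨s, hs, hsp⟩ := exists_lt_of_csInf_lt ⟨r, hr⟩ h
  obtain ⟨i, hi⟩ := exists_lam_ne_zero hM 0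
  rw [shift_zero] at hi
  exact (piQ_strictAnti hs.1.1 hsp hi).trans_le (piQ_lam_le_one_of_mem hM hs)

/-- The set of eventually periodic digit sequences is countable. -/
lemma countable_eventually_periodic :
    {d : Digits M | ∃ i p, 0 < p ∧ shift (i + p) d = shift i d}.Countable := by
  have : {d : Digits M | ∃ i p, 0 < p ∧ shift (i + p) d = shift i d} =
      ⋃ (i : ℕ) (p : ℕ), {d : Digits M | 0 < p ∧ shift (i + p) d = shift i d} := by
    ext d; simp
  rw [this]
  refine Set.countable_iUnion fun i => Set.countable_iUnion fun p => Set.Finite.countable ?_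
  refine Set.Finite.of_injOn (f := fun (d : Digits M) (l : Fin (i + p)) => d l)
    (t := Set.univ) (fun _ _ => Set.mem_univ _) ?_ Set.finite_univ
  rintro d ⟨hp, hd⟩ e ⟨-, he⟩ hde
  funext n
  induction n using Nat.strong_induction_on with
  | _ n ih =>
    rcases lt_or_ge n (i + p) with hn | hn
    · exact congrFun hde ⟨n, hn⟩
    · obtain ⟨r, rfl⟩ := Nat.exists_eq_add_of_le hn
      have h1 := congrFun hd r
      have h2 := congrFun he r
      simp only [shift_apply] at h1 h2
      rw [h1, h2]
      exact ih _ (by omega)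

/-- Concatenation of Thue–Morse blocks of length `2 ^ k`, complemented according to `b`. -/
def blockPar (k : ℕ) (b : ℕ → Bool) (i : ℕ) : Bool := xor (b (i / 2 ^ k)) (par (i % 2 ^ k))

lemma blockPar_mul_add (k : ℕ) (b : ℕ → Bool) (i r : ℕ) (hr : r < 2 ^ k) :
    blockPar k b (2 ^ k * i + r) = xor (b i) (par r) := by
  rw [blockPar, Nat.mul_add_mod, Nat.mod_eq_of_lt hr, Nat.mul_add_div (by positivity),
    Nat.div_eq_of_lt hr, add_zero]

lemma exists_par_pair (x y : Bool) : ∃ j, par j = x ∧ par (j + 1) = y := by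
  have h3 : par 3 = false := by simpa [par_one] using par_two_mul_add_one 1
  have h5 : par 5 = false := by simpa [par_two] using par_two_mul_add_one 2
  have h6 : par 6 = false := by simpa [h3] using par_two_mul 3
  cases x <;> cases y
  · exact ⟨5, h5, h6⟩
  · exact ⟨0, par_zero, par_one⟩
  · exact ⟨2, par_two, h3⟩
  · exact ⟨1, par_one, par_two⟩

lemma exists_blockPar_eq_par (k : ℕ) (b : ℕ → Bool) (n : ℕ) :
    ∃ m, ∀ l ≤ 2 ^ k, blockPar k b (n + l) = par (m + l) := by
  have hpos : 0 < 2 ^ k := by positivity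
  have hr := Nat.mod_lt n hpos
  have hn := Nat.div_add_mod n (2 ^ k)
  set i := n / 2 ^ k
  set r := n % 2 ^ k
  obtain ⟨j, hj1, hj2⟩ := exists_par_pair (b i) (b (i + 1))
  refine ⟨2 ^ k * j + r, fun l hl => ?_⟩
  rcases lt_or_ge (r + l) (2 ^ k) with h | h
  · rw [← hn, add_assoc, add_assoc, blockPar_mul_add k b i _ h, par_pow_mul_add k j _ h, hj1]
  · obtain ⟨s, hs⟩ := Nat.exists_eq_add_of_le h
    have e1 : n + l = 2 ^ k * (i + 1) + s := by rw [mul_add]; omega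
    have e2 : 2 ^ k * j + r + l = 2 ^ k * (j + 1) + s := by rw [mul_add]; omega
    rw [e1, e2, blockPar_mul_add k b _ s (by omega), par_pow_mul_add k _ s (by omega), hj2]

lemma refl_code_blockPar (hM : 0 < M) (k : ℕ) (b : ℕ → Bool) :
    refl (code M (blockPar k b)) = code M (blockPar k fun i => !b i) := by
  rw [refl_code hM]
  congr 1
  funext i
  simp [blockPar]

lemma piQ_shift_code_blockPar_lt_one (hM : 0 < M) {p : ℝ} (hp : 1 < p) {k : ℕ}
    (h : piQ M p (lam M) + M / (p - 1) / p ^ 2 ^ k < 1) (b : ℕ → Bool) (n : ℕ) :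
    piQ M p (shift n (code M (blockPar k b))) < 1 := by
  have hC : 0 ≤ M / (p - 1) / p ^ 2 ^ k :=
    div_nonneg (div_nonneg (Nat.cast_nonneg _) (by linarith)) (by positivity)
  refine piQ_shift_lt_one_of_lexLt hp (a := lam M) (by linarith) (piQ_shift_lam_pos hM hp)
    (fun n => ?_) n
  obtain ⟨m, hm⟩ := exists_blockPar_eq_par k b n
  have hag : ∀ i < 2 ^ k, shift n (code M (blockPar k b)) i = shift m (lam M) i := by
    rw [shift_code, lam, shift_code]
    exact fun i hi => code_congr hm i hi
  have hval : (∀ i < 2 ^ k, shift n (code M (blockPar k b)) i = lam M i) →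
      piQ M p (shift n (code M (blockPar k b))) < 1 := fun hh => by
    have := abs_piQ_sub_le hp hh
    linarith [(abs_le.1 this).2]
  rcases Nat.eq_zero_or_pos m with rfl | hpos
  · exact Or.inr (hval (by simpa using hag))
  obtain ⟨j, hj, hlt⟩ := shift_lam_lexLt hM m hpos
  rcases lt_or_ge j (2 ^ k) with hjk | hjk
  · exact Or.inl ⟨j, fun i hi => (hag i (hi.trans hjk)).trans (hj i hi), by rwa [hag j hjk]⟩
  · exact Or.inr (hval fun i hi => (hag i hi).trans (hj i (hi.trans_le hjk)))

/-- Above the Komornik–Loreti base there is a family of digit sequences, all of whose shifts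
and reflected shifts have value less than `1`, encoding arbitrary Boolean sequences. -/
lemma exists_free_family (hM : 0 < M) {p : ℝ} (hp : 1 < p) (h : piQ M p (lam M) < 1) :
    ∃ (K : ℕ) (c : (ℕ → Bool) → Digits M), 0 < K ∧
      (∀ b n, piQ M p (shift n (c b)) < 1 ∧ piQ M p (refl (shift n (c b))) < 1) ∧
      ∀ b i, ((c b (K * i) : ℕ) = M / 2 + 1 ↔ b i = false) := by
  have h3 : Filter.Tendsto (fun n : ℕ => (M / (p - 1)) / p ^ 2 ^ n) Filter.atTop (nhds 0) :=
    (tendsto_const_nhds.div_atTop (tendsto_pow_atTop_atTop_of_one_lt hp)).comp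
      (tendsto_pow_atTop_atTop_of_one_lt (one_lt_two))
  obtain ⟨k, hk, hk1⟩ := ((h3.eventually (gt_mem_nhds (sub_pos.2 h))).and
    (Filter.eventually_ge_atTop 1)).exists
  have hk' : piQ M p (lam M) + M / (p - 1) / p ^ 2 ^ k < 1 := by linarith
  refine ⟨2 ^ k, fun b => code M (blockPar k b), by positivity, fun b n => ⟨?_, ?_⟩, fun b i => ?_⟩
  · exact piQ_shift_code_blockPar_lt_one hM hp hk' b n
  · rw [← shift_refl, refl_code_blockPar hM]
    exact piQ_shift_code_blockPar_lt_one hM hp hk' _ n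
  · have e := code_val hM (blockPar k b) (2 ^ k * i)
    have e0 := blockPar_mul_add k b i 0 (by positivity)
    rw [add_zero] at e0
    rw [blockPar_mul_add k b i 1 (Nat.one_lt_two_pow (by omega)), e0, par_zero, par_one] at e
    cases hb : b i <;> simp only [hb, Bool.xor_true, Bool.xor_false, Bool.not_true, Bool.not_false,
      Bool.toNat_true, Bool.toNat_false] at e <;> split_ifs at e <;> simp <;> omega

lemma rho_of_ne {c d : Digits M} (h : c ≠ d) : ∃ j, (∀ i < j, c i = d i) ∧ c j ≠ d j ∧
    rho M c d = (((M : ℝ) + 1) ^ (j + 1))⁻¹ := by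
  have hne : {i | c i ≠ d i}.Nonempty := by
    by_contra hcon
    rw [Set.not_nonempty_iff_eq_empty, Set.eq_empty_iff_forall_notMem] at hcon
    exact h (funext fun i => by simpa using hcon i)
  refine ⟨sInf {i | c i ≠ d i}, fun i hi => by simpa using Nat.notMem_of_lt_sInf hi,
    Nat.sInf_mem hne, ?_⟩
  rw [rho, if_neg h, zpow_neg]
  norm_cast

lemma rho_self (c : Digits M) : rho M c c = 0 := by simp [rho]

lemma rho_nonneg (c d : Digits M) : 0 ≤ rho M c d := by
  by_cases h : c = d
  · rw [h, rho_self]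
  · obtain ⟨j, -, -, e⟩ := rho_of_ne h
    rw [e]; positivity

lemma rho_comm (c d : Digits M) : rho M c d = rho M d c := by
  by_cases h : c = d
  · rw [h]
  · rw [rho, rho, if_neg h, if_neg (Ne.symm h)]
    simp only [ne_comm]

lemma le_rho {c d : Digits M} {j : ℕ} (h : c j ≠ d j) :
    (((M : ℝ) + 1) ^ (j + 1))⁻¹ ≤ rho M c d := by
  obtain ⟨i, hi, -, e⟩ := rho_of_ne (fun h0 => h (congrFun h0 j))
  have hij : i ≤ j := by
    by_contra hcon
    exact h (hi j (by omega))
  rw [e]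
  gcongr
  linarith [(Nat.cast_nonneg M : (0 : ℝ) ≤ M)]

lemma rho_le_of_agree {c d : Digits M} {n : ℕ} (h : ∀ i < n, c i = d i) :
    rho M c d ≤ (((M : ℝ) + 1) ^ (n + 1))⁻¹ := by
  by_cases hcd : c = d
  · rw [hcd, rho_self]; positivity
  · obtain ⟨j, -, hj, e⟩ := rho_of_ne hcd
    have hij : n ≤ j := by
      by_contra hcon
      exact hj (h j (by omega))
    rw [e]
    gcongr
    linarith [(Nat.cast_nonneg M : (0 : ℝ) ≤ M)]

lemma rho_triangle (c d e : Digits M) : rho M c e ≤ rho M c d + rho M d e := by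
  by_cases h : c = e
  · rw [h, rho_self]; exact add_nonneg (rho_nonneg _ _) (rho_nonneg _ _)
  · obtain ⟨j, -, hj, he⟩ := rho_of_ne h
    rw [he]
    by_cases hcd : c j = d j
    · have := le_rho (c := d) (d := e) (j := j) (by rwa [← hcd])
      linarith [rho_nonneg c d]
    · have := le_rho hcd
      linarith [rho_nonneg d e]

/-- The space of digit sequences, equipped with the metric `rho`. -/
def DigitSpace (M : ℕ) : Type := Digits M

noncomputable instance : MetricSpace (DigitSpace M) where
  dist := rho M
  dist_self := rho_self
  dist_comm := rho_comm
  dist_triangle := rho_triangle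
  eq_of_dist_eq_zero := by
    intro c d h
    by_contra hcd
    obtain ⟨j, -, -, e⟩ := rho_of_ne hcd
    have h' : rho M c d = 0 := h
    rw [e] at h'
    have : (0 : ℝ) < (((M : ℝ) + 1) ^ (j + 1))⁻¹ := by positivity
    linarith

lemma gdiam_dist {X : Type*} [MetricSpace X] (A : Set X) : gdiam dist A = Metric.ediam A := by
  simp only [gdiam, Metric.ediam, edist_dist]

lemma gHMeasure_dist {X : Type*} [MetricSpace X] [MeasurableSpace X] [BorelSpace X] {s : ℝ}
    (hs : 0 < s) (A : Set X) :
    gHMeasure dist s A = MeasureTheory.Measure.hausdorffMeasure s A := by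
  rw [MeasureTheory.Measure.hausdorffMeasure_apply, gHMeasure]
  have hsum : ∀ C : ℕ → Set X, ∑' n, Metric.ediam (C n) ^ s =
      ∑' n, ⨆ _ : (C n).Nonempty, Metric.ediam (C n) ^ s := by
    refine fun C => tsum_congr fun n => ?_
    rcases (C n).eq_empty_or_nonempty with h | h
    · simp [h, hs]
    · simp [h]
  simp only [gdiam_dist, hsum]
  apply le_antisymm
  · refine iSup₂_le fun δ hδ => ?_
    exact le_iSup₂_of_le (ENNReal.ofReal δ) (ENNReal.ofReal_pos.2 hδ) le_rfl
  · refine iSup₂_le fun r hr => ?_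
    obtain ⟨δ, hδ, hle⟩ : ∃ δ : ℝ, 0 < δ ∧ ENNReal.ofReal δ ≤ r := by
      obtain ⟨t, ht, htr⟩ := ENNReal.lt_iff_exists_nnreal_btwn.1 hr
      exact ⟨t, by exact_mod_cast ht, by simpa using htr.le⟩
    refine le_iSup₂_of_le δ hδ ?_
    refine iInf_mono fun C => iInf_mono fun _ => ?_
    exact iInf_mono' fun h => ⟨fun n => (h n).trans hle, le_rfl⟩

lemma gdimH_dist {X : Type*} [MetricSpace X] (A : Set X) : gdimH dist A = dimH A := by
  borelize X
  rw [dimH_def, gdimH]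
  apply le_antisymm
  · refine iSup₂_le fun s hs => ?_
    rcases eq_or_ne s 0 with rfl | h0
    · simp
    · rw [gHMeasure_dist (by exact_mod_cast pos_iff_ne_zero.2 h0)] at hs
      exact le_iSup₂_of_le s hs le_rfl
  · refine iSup₂_le fun s hs => ?_
    rcases eq_or_ne s 0 with rfl | h0
    · simp
    · rw [← gHMeasure_dist (by exact_mod_cast pos_iff_ne_zero.2 h0)] at hs
      exact le_iSup₂_of_le s hs le_rfl

lemma gdimH_rho (A : Set (Digits M)) : gdimH (rho M) A = dimH (X := DigitSpace M) A :=
  gdimH_dist (X := DigitSpace M) A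

lemma le_gdimH_of_decode {B : ℕ} (hB : 0 < B) {S : Set (Digits M)} (pos : ℕ → ℕ)
    (dec : Fin (M + 1) → Fin (B + 1))
    (hS : ∀ b : Digits B, ∃ d ∈ S, ∀ i, dec (d (pos i)) = b i) {r C : ℝ≥0} (hr : 0 < r)
    (hC : ∀ i, (((B : ℝ) + 1) ^ i)⁻¹ ≤ C * ((((M : ℝ) + 1) ^ (pos i + 1))⁻¹) ^ (r : ℝ)) :
    (r : ℝ≥0∞) ≤ gdimH (rho M) S := by
  rw [gdimH_rho]
  have hB1 := one_lt_cast_add_one hB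
  have hB0 : (B : ℝ) ≠ 0 := by positivity
  let f : DigitSpace M → ℝ := fun d => piQ B (B + 1) fun i => dec (d (pos i))
  have hf : HolderOnWith C r f S := by
    intro d _ e _
    have hnn : 0 ≤ C * dist d e ^ (r : ℝ) := by positivity
    rw [edist_dist, edist_dist, ENNReal.ofReal_rpow_of_nonneg dist_nonneg r.coe_nonneg,
      ← ENNReal.ofReal_coe_nnreal (p := C), ← ENNReal.ofReal_mul C.coe_nonneg]
    refine ENNReal.ofReal_le_ofReal ?_
    by_cases hde : (fun i => dec (d (pos i))) = fun i => dec (e (pos i))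
    · simp only [f, hde, dist_self]
      exact hnn
    · obtain ⟨i, hi, hne, -⟩ := rho_of_ne hde
      have h1 := abs_piQ_sub_le hB1 hi
      rw [add_sub_cancel_right, div_self hB0, one_div] at h1
      refine (h1.trans (hC i)).trans ?_
      have h2 : (((M : ℝ) + 1) ^ (pos i + 1))⁻¹ ≤ dist d e :=
        le_rho (c := d) (d := e) fun h => hne (congrArg dec h)
      gcongr
  have h1 : Set.Icc (0 : ℝ) 1 ⊆ f '' S := by
    intro y hy
    obtain ⟨b, hb⟩ := exists_expansion hB1 le_rfl (x := y)
      (by rwa [add_sub_cancel_right, div_self hB0])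
    obtain ⟨d, hd, hdb⟩ := hS b
    exact ⟨d, hd, by simp only [f, hdb, hb]⟩
  have h2 : dimH (Set.Icc (0 : ℝ) 1) = 1 := by
    rw [Real.dimH_of_mem_nhds (x := 1 / 2) (Icc_mem_nhds (by norm_num) (by norm_num))]
    simp
  have h3 := (h2.ge.trans (dimH_mono h1)).trans (hf.dimH_image_le hr)
  rw [ENNReal.le_div_iff_mul_le (Or.inl (by exact_mod_cast hr.ne')) (Or.inl ENNReal.coe_ne_top),
    one_mul] at h3
  exact h3

lemma gdimH_mono {S T : Set (Digits M)} (h : S ⊆ T) : gdimH (rho M) S ≤ gdimH (rho M) T := by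
  rw [gdimH_rho, gdimH_rho]
  exact dimH_mono (X := DigitSpace M) h

lemma gdimH_countable {S : Set (Digits M)} (h : S.Countable) : gdimH (rho M) S = 0 := by
  rw [gdimH_rho]
  exact dimH_countable (X := DigitSpace M) h

lemma gdimH_iUnion (S : ℕ → Set (Digits M)) :
    gdimH (rho M) (⋃ n, S n) = ⨆ n, gdimH (rho M) (S n) := by
  simp only [gdimH_rho]
  exact dimH_iUnion (X := DigitSpace M) S

lemma ediam_le_of_agree {S : Set (DigitSpace M)} {n : ℕ}
    (h : ∀ c ∈ S, ∀ d ∈ S, ∀ i < n, c i = d i) :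
    Metric.ediam S ≤ ENNReal.ofReal ((((M : ℝ) + 1) ^ n)⁻¹) := by
  refine Metric.ediam_le fun c hc d hd => ?_
  rw [edist_dist]
  refine ENNReal.ofReal_le_ofReal ((rho_le_of_agree (h c hc d hd)).trans ?_)
  have hM1 : (1 : ℝ) ≤ M + 1 := by linarith [(Nat.cast_nonneg M : (0 : ℝ) ≤ M)]
  gcongr
  omega

/-- Upper bound for the dimension of the set of sequences which after a prefix of length `N` are
concatenations of words from `W`. -/
lemma gdimH_blocks_le (hM : 0 < M) {k : ℕ} (hk : 0 < k) (W : Finset (Fin k → Fin (M + 1)))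
    (N : ℕ) {s : ℝ≥0} (hW : (W.card : ℝ) ≤ (((M : ℝ) + 1) ^ k) ^ (s : ℝ)) :
    gdimH (rho M) {d : Digits M | ∀ j, (fun l : Fin k => d (N + k * j + l)) ∈ W} ≤ s := by
  rw [gdimH_rho]
  borelize (DigitSpace M)
  refine dimH_le_of_hausdorffMeasure_ne_top (ne_top_of_le_ne_top (b := ((M + 1 : ℕ) : ℝ≥0∞) ^ N)
    (ENNReal.pow_ne_top (ENNReal.natCast_ne_top _)) ?_)
  have hβ := one_lt_cast_add_one hM
  let t : ∀ n, (Fin N → Fin (M + 1)) × (Fin n → W) → Set (DigitSpace M) := fun n i =>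
    {d | (∀ l : Fin N, d l = i.1 l) ∧ ∀ (j : Fin n) (l : Fin k), d (N + k * j + l) = (i.2 j).1 l}
  have hdiam : ∀ n i, Metric.ediam (t n i) ≤ ENNReal.ofReal ((((M : ℝ) + 1) ^ k) ^ n)⁻¹ := by
    intro n i
    rw [← pow_mul]
    refine ediam_le_of_agree fun c hc d hd m hm => ?_
    rcases lt_or_ge m N with h | h
    · exact (hc.1 ⟨m, h⟩).trans (hd.1 ⟨m, h⟩).symm
    · obtain ⟨r, rfl⟩ := Nat.exists_eq_add_of_le h
      have hj : r / k < n := by rw [Nat.div_lt_iff_lt_mul hk, mul_comm]; omega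
      have := (hc.2 ⟨r / k, hj⟩ ⟨r % k, Nat.mod_lt _ hk⟩).trans
        (hd.2 ⟨r / k, hj⟩ ⟨r % k, Nat.mod_lt _ hk⟩).symm
      simpa only [add_assoc, Nat.div_add_mod] using this
  have hr : Filter.Tendsto (fun n : ℕ => ENNReal.ofReal ((((M : ℝ) + 1) ^ k) ^ n)⁻¹) Filter.atTop
      (nhds 0) := by
    rw [← ENNReal.ofReal_zero]
    exact ENNReal.tendsto_ofReal (tendsto_inv_atTop_zero.comp
      (tendsto_pow_atTop_atTop_of_one_lt (one_lt_pow₀ hβ hk.ne')))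
  refine (MeasureTheory.Measure.hausdorffMeasure_le_liminf_sum (s : ℝ) _ _ hr t
    (Filter.Eventually.of_forall hdiam) (Filter.Eventually.of_forall fun n d hd => ?_)).trans ?_
  · exact Set.mem_iUnion.2 ⟨(fun l => d l, fun j => ⟨_, hd j⟩), fun l => rfl, fun j l => rfl⟩
  · refine Filter.liminf_le_of_frequently_le' (Filter.Frequently.of_forall fun n => ?_)
    refine (Finset.sum_le_sum fun i _ =>
      ENNReal.rpow_le_rpow (hdiam n i) s.coe_nonneg).trans ?_
    rw [Finset.sum_const, Finset.card_univ, Fintype.card_prod, Fintype.card_fun, Fintype.card_fun,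
      Fintype.card_fin, Fintype.card_fin, Fintype.card_fin, Fintype.card_coe, nsmul_eq_mul,
      Nat.cast_mul, Nat.cast_pow, mul_assoc]
    refine (mul_le_mul_right (b := _) (c := 1) ?_ _).trans_eq (mul_one _)
    rw [ENNReal.ofReal_rpow_of_nonneg (by positivity) s.coe_nonneg, ← ENNReal.ofReal_natCast,
      ← ENNReal.ofReal_mul (by positivity), ← ENNReal.ofReal_one]
    refine ENNReal.ofReal_le_ofReal ?_
    rw [Real.inv_rpow (by positivity), ← Real.rpow_natCast, ← Real.rpow_mul (by positivity),
      mul_comm (n : ℝ), Real.rpow_mul (by positivity), Real.rpow_natCast, Nat.cast_pow,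
      ← div_eq_mul_inv, ← div_pow]
    refine pow_le_one₀ (by positivity) ((div_le_one (by positivity)).2 hW)

lemma gdimH_le_of_eventually_blocks (hM : 0 < M) {k : ℕ} (hk : 0 < k)
    (W : Finset (Fin k → Fin (M + 1))) {s : ℝ≥0}
    (hW : (W.card : ℝ) ≤ (((M : ℝ) + 1) ^ k) ^ (s : ℝ)) {S : Set (Digits M)}
    (hS : ∀ d ∈ S, ∃ N, ∀ j, (fun l : Fin k => d (N + k * j + l)) ∈ W) :
    gdimH (rho M) S ≤ s := by
  have h : S ⊆ ⋃ N, {d : Digits M | ∀ j, (fun l : Fin k => d (N + k * j + l)) ∈ W} :=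
    fun d hd => Set.mem_iUnion.2 (hS d hd)
  refine (gdimH_mono h).trans ?_
  rw [gdimH_iUnion]
  exact iSup_le fun N => gdimH_blocks_le hM hk W N hW

lemma gdimH_le_one (hM : 0 < M) (S : Set (Digits M)) : gdimH (rho M) S ≤ 1 := by
  refine gdimH_le_of_eventually_blocks hM one_pos Finset.univ (s := 1) ?_
    fun d _ => ⟨0, fun j => Finset.mem_univ _⟩
  simp

lemma gdimH_UxSym_eq_zero (hM : 0 < M) {x : ℝ} (hx : 0 < x) (h : M / (qKL M - 1) ≤ x) :
    gdimH (rho M) (UxSym M x) = 0 := by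
  have hK := one_lt_qKL hM
  refine gdimH_countable (Set.Countable.mono ?_ (countable_eventually_periodic.union
    (Set.Subsingleton.countable (s := {d : Digits M | piQ M (qKL M) d = x ∧ d ∈ UqSym M (qKL M)})
      fun d hd e he => he.2 _ (hd.1.trans he.1.symm))))
  intro d hd
  obtain ⟨q, hq, hdx, hu⟩ := (mem_UxSym_iff hx d).1 hd
  have hle : q ≤ qKL M := by
    have h1 := piQ_le hq.1 d
    rw [hdx] at h1
    have h2 := h.trans h1
    rw [div_le_div_iff_of_pos_left (by exact_mod_cast hM) (by linarith) (by linarith [hq.1])] at h2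
    linarith
  rcases hle.lt_or_eq with hlt | rfl
  · exact Or.inl ((tame_of_mem_UqSym hq.1 hq.2 hu).eventually_periodic hM hq.1 hq.2
      (one_lt_piQ_lam_of_lt_qKL hM hq.1 hlt))
  · exact Or.inr ⟨hdx, hu⟩

/-- Values of `q` in `𝒰(x)` are at most `1 + M / x`. -/
lemma le_one_add_div {x q : ℝ} (hx : 0 < x) (hq : 1 < q) {d : Digits M} (h : piQ M q d = x) :
    q ≤ 1 + M / x := by
  have h1 := piQ_le hq d
  rw [h, le_div_iff₀ (by linarith)] at h1
  have : q - 1 ≤ M / x := by rw [le_div_iff₀ hx]; linarith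
  linarith

lemma tendsto_const_div_pow {q : ℝ} (hq : 1 < q) (C : ℝ) :
    Filter.Tendsto (fun n : ℕ => C / q ^ n) Filter.atTop (nhds 0) :=
  tendsto_const_nhds.div_atTop (tendsto_pow_atTop_atTop_of_one_lt hq)

lemma exists_prep_last_gt {q y : ℝ} (hq : 1 < q) (h : y < M / (q - 1)) :
    ∃ N, ∀ n ≥ N, ∀ c : Digits M, y < piQ M q (prep n (fun _ => Fin.last M) c) := by
  obtain ⟨N, hN⟩ := Filter.eventually_atTop.1
    ((tendsto_const_div_pow hq (M / (q - 1))).eventually (gt_mem_nhds (sub_pos.2 h)))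
  refine ⟨N, fun n hn c => ?_⟩
  have h1 := abs_piQ_sub_le hq (d := prep n (fun _ => Fin.last M) c) (e := fun _ => Fin.last M)
    (n := n) fun i hi => by simp [prep, hi]
  rw [piQ_last hq] at h1
  linarith [(abs_le.1 h1).1, hN n hn]

lemma exists_card_exponent (P : ℕ) (hP : 2 ≤ P) :
    ∃ s : ℝ≥0, s < 1 ∧ ((P - 1 : ℕ) : ℝ) ≤ (P : ℝ) ^ (s : ℝ) := by
  have hP' : (2 : ℝ) ≤ P := by exact_mod_cast hP
  have e : ((P - 1 : ℕ) : ℝ) = P - 1 := by rw [Nat.cast_sub (by omega), Nat.cast_one]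
  refine ⟨⟨Real.logb P (P - 1), Real.logb_nonneg (by linarith) (by linarith)⟩, ?_, ?_⟩
  · refine NNReal.coe_lt_coe.1 ?_
    change Real.logb P (P - 1) < 1
    exact (Real.logb_lt_logb (by linarith) (by linarith) (by linarith)).trans_eq
      (Real.logb_self_eq_one (by linarith))
  · change _ ≤ (P : ℝ) ^ Real.logb P (P - 1)
    rw [Real.rpow_logb (by linarith) (by linarith) (by linarith), e]

lemma gdimH_UxSym_lt_one (hM : 0 < M) {x : ℝ} (hx : 1 < x) : gdimH (rho M) (UxSym M x) < 1 := by
  have hM' : (0 : ℝ) < M := by exact_mod_cast hM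
  have hx0 : 0 < x := by linarith
  set Q := 1 + M / x with hQdef
  have hQ : 1 < Q := by
    have : 0 < M / x := by positivity
    linarith
  obtain ⟨N, hN⟩ := exists_prep_last_gt (M := M) hQ (y := 1)
    (by rw [hQdef, add_sub_cancel_left, div_div_cancel₀ hM'.ne']; exact hx)
  set k := N + 1
  have hk : 0 < k := Nat.succ_pos N
  let W : Finset (Fin k → Fin (M + 1)) := Finset.univ.erase fun _ => Fin.last M
  obtain ⟨s, hs, hsP⟩ := exists_card_exponent ((M + 1) ^ k)
    ((Nat.succ_le_succ hM).trans (Nat.le_self_pow hk.ne' _))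
  have hW : (W.card : ℝ) ≤ (((M : ℝ) + 1) ^ k) ^ (s : ℝ) := by
    rw [Finset.card_erase_of_mem (Finset.mem_univ _), Finset.card_univ, Fintype.card_fun,
      Fintype.card_fin, Fintype.card_fin]
    simpa using hsP
  have hsub : UxSym M x ⊆ {fun _ => Fin.last M} ∪ (UxSym M x \ {fun _ => Fin.last M}) := by simp
  refine (gdimH_mono hsub).trans_lt ?_
  have hun : ∀ S T : Set (Digits M), gdimH (rho M) (S ∪ T) =
      max (gdimH (rho M) S) (gdimH (rho M) T) := fun S T => by
    simp only [gdimH_rho]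
    exact dimH_union (X := DigitSpace M) S T
  rw [hun, gdimH_countable (Set.countable_singleton _)]
  refine max_lt zero_lt_one (lt_of_le_of_lt
    (gdimH_le_of_eventually_blocks hM hk W hW fun d hd => ?_) (by exact_mod_cast hs))
  obtain ⟨q, hq, hdx, hu⟩ := (mem_UxSym_iff hx0 d).1 hd.1
  have hqQ := le_one_add_div hx0 hq.1 hdx
  have hT := tame_of_mem_UqSym hq.1 hq.2 hu
  obtain ⟨n, hn⟩ : ∃ n, d n ≠ Fin.last M := by
    by_contra hcon
    push Not at hcon
    exact hd.2 (funext hcon)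
  refine ⟨n + 1, fun j => Finset.mem_erase.2 ⟨fun hc => ?_, Finset.mem_univ _⟩⟩
  have h1 := hT.shift_lt_one hq.1 hq.2 (hT.1 n hn) (m := n + 1 + k * j) (by omega)
  have h2 := hN k (by omega) (fun _ => 0)
  have h3 := piQ_antitone hq.1 hqQ (prep k (fun _ => Fin.last M) fun _ => 0)
  have h4 : piQ M q (prep k (fun _ => Fin.last M) fun _ => 0) ≤
      piQ M q (shift (n + 1 + k * j) d) := by
    refine piQ_mono hq.1 fun i => ?_
    by_cases hi : i < k
    · simp only [prep, if_pos hi, shift_apply]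
      exact (congrFun hc ⟨i, hi⟩).ge
    · simp [prep, hi]
  linarith

lemma tame_prep_last {q : ℝ} (hq : 1 < q) {c : Digits M} (N : ℕ)
    (h1 : ∀ n, piQ M q (shift n c) < 1) (h2 : ∀ n, piQ M q (refl (shift n c)) < 1) :
    Tame q (prep N (fun _ => Fin.last M) c) := by
  refine ⟨fun n hn => ?_, fun n _ => ?_⟩
  · obtain ⟨r, hr⟩ := Nat.exists_eq_add_of_le (show N ≤ n + 1 by
      by_contra hcon
      exact hn (by simp only [prep, if_pos (show n < N by omega)]))
    rw [hr, shift_prep]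
    exact h1 r
  · rcases le_or_gt N (n + 1) with h | h
    · obtain ⟨r, hr⟩ := Nat.exists_eq_add_of_le h
      rw [hr, shift_prep]
      exact h2 r
    · have key : ∀ t m, m + t = N →
          piQ M q (shift m (refl (prep N (fun _ => Fin.last M) c))) < 1 := by
        intro t
        induction t with
        | zero =>
          rintro m rfl
          rw [shift_refl, add_zero, shift_prep_self]
          simpa using h2 0
        | succ t ih =>
          intro m hm
          have h3 := ih (m + 1) (by omega)
          have h4 : refl (prep N (fun _ => Fin.last M) c) m = 0 := by
            rw [refl_apply, prep, if_pos (by omega), Fin.rev_last]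
          rw [piQ_shift_succ hq, h4, div_lt_one (by linarith), Fin.val_zero]
          norm_num
          linarith
      rw [← shift_refl]
      exact key (N - (n + 1)) (n + 1) (by omega)

lemma gdimH_UxSym_pos (hM : 0 < M) {x : ℝ} (hx : 1 < x) (h : x < M / (qKL M - 1)) :
    0 < gdimH (rho M) (UxSym M x) := by
  have hM' : (0 : ℝ) < M := by exact_mod_cast hM
  have hx0 : 0 < x := by linarith
  have hK := one_lt_qKL hM
  have hKQ : qKL M < 1 + M / x := by
    rw [lt_div_iff₀ (by linarith)] at h
    have : qKL M - 1 < M / x := by rw [lt_div_iff₀ hx0]; linarith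
    linarith
  have hQM : 1 + M / x < (M : ℝ) + 1 := by
    have : M / x < (M : ℝ) := div_lt_self hM' hx
    linarith
  obtain ⟨p, hKp, hpQ⟩ := exists_between hKQ
  have hp : 1 < p := by linarith
  obtain ⟨K, c, hK0, hc, hdec⟩ := exists_free_family hM hp (piQ_lam_lt_one_of_qKL_lt hM hKp)
  obtain ⟨N, hN⟩ := exists_prep_last_gt (M := M) hp (y := x) (by
    rw [lt_div_iff₀ (by linarith)]
    have := sub_lt_sub_right hpQ 1
    rw [add_sub_cancel_left, lt_div_iff₀ hx0] at this
    linarith)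
  have hmem : ∀ b, prep N (fun _ => Fin.last M) (c b) ∈ UxSym M x := by
    intro b
    rw [mem_UxSym_iff hx0]
    obtain ⟨q, hq, hqx⟩ := exists_base hp hpQ.le (prep N (fun _ => Fin.last M) (c b))
      ((piQ_le (by linarith) _).trans_eq
        (by rw [add_sub_cancel_left, div_div_cancel₀ hM'.ne'])) (hN N le_rfl (c b)).le
    have hq1 : 1 < q := by linarith [hq.1]
    refine ⟨q, ⟨hq1, by linarith [hq.2]⟩, hqx, Tame.mem_UqSym hq1 (tame_prep_last hq1 N ?_ ?_)⟩
    · exact fun n => (piQ_antitone hp hq.1 _).trans_lt (hc b n).1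
    · exact fun n => (piQ_antitone hp hq.1 _).trans_lt (hc b n).2
  have hP : 1 < ((M : ℝ) + 1) ^ K := one_lt_pow₀ (one_lt_cast_add_one hM) hK0.ne'
  let r : ℝ≥0 := ⟨Real.logb (((M : ℝ) + 1) ^ K) 2, (Real.logb_pos hP one_lt_two).le⟩
  have hr : 0 < r := Real.logb_pos hP one_lt_two
  have hPr : (((M : ℝ) + 1) ^ K) ^ (r : ℝ) = 2 := Real.rpow_logb (by linarith) hP.ne' two_pos
  let C : ℝ≥0 := ⟨(((M : ℝ) + 1) ^ (N + 1)) ^ (r : ℝ), by positivity⟩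
  refine lt_of_lt_of_le (ENNReal.coe_pos.2 hr) (le_gdimH_of_decode (B := 1) one_pos
    (fun i => N + K * i) (fun a => if (a : ℕ) = M / 2 + 1 then 0 else 1) (fun b => ?_) hr
    (C := C) fun i => ?_)
  · refine ⟨_, hmem fun i => decide (b i ≠ 0), fun i => ?_⟩
    have h1 : prep N (fun _ => Fin.last M) (c fun i => decide (b i ≠ 0)) (N + K * i) =
        c (fun i => decide (b i ≠ 0)) (K * i) := by
      have := congrFun (shift_prep N (fun _ => Fin.last M) (c fun i => decide (b i ≠ 0)) (K * i)) 0
      simpa [shift_apply] using this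
    have h2 := hdec (fun i => decide (b i ≠ 0)) i
    by_cases hb : b i = 0
    · rw [h1, if_pos (h2.2 (by simp [hb])), hb]
    · rw [h1, if_neg fun h => hb (by simpa using h2.1 h)]
      exact (Fin.eq_one_of_ne_zero _ hb).symm
  · have e : ((((M : ℝ) + 1) ^ K) ^ i) ^ (r : ℝ) = 2 ^ i := by
      rw [← Real.rpow_natCast _ i, ← Real.rpow_mul (by positivity), mul_comm (i : ℝ),
        Real.rpow_mul (by positivity), hPr, Real.rpow_natCast]
    change _ ≤ (((M : ℝ) + 1) ^ (N + 1)) ^ (r : ℝ) * _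
    rw [show N + K * i + 1 = (N + 1) + K * i by ring, pow_add _ (N + 1), pow_mul]
    push_cast
    rw [Real.inv_rpow (by positivity), Real.mul_rpow (by positivity) (by positivity), e, mul_inv,
      ← mul_assoc, mul_inv_cancel₀ (by positivity), one_mul]
    norm_num

lemma piQ_refl_lt_one_of_digit {q : ℝ} (hq : 3 / 2 ≤ q) (hqM : q < M + 1) {e : Digits M} {j : ℕ}
    (hj : e j ≠ 0) (h : 2 * ((M : ℝ) + 1 - q) ≤ (((M : ℝ) + 1) ^ (j + 1))⁻¹) :
    piQ M q (refl e) < 1 := by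
  have hq1 : 1 < q := by linarith
  have h0 : (0 : ℝ) < q := by linarith
  have h1 : (1 : ℝ) ≤ (e j : ℕ) := by
    exact_mod_cast Nat.pos_of_ne_zero fun h => hj (Fin.ext h)
  have h2 : (((M : ℝ) + 1) ^ (j + 1))⁻¹ < (e j : ℕ) / q ^ (j + 1) := by
    rw [inv_eq_one_div]
    calc 1 / ((M : ℝ) + 1) ^ (j + 1) < 1 / q ^ (j + 1) := by gcongr
      _ ≤ _ := by gcongr
  have h3 := digit_le_piQ hq1 e j
  have h4 : (M : ℝ) / (q - 1) ≤ 1 + 2 * ((M : ℝ) + 1 - q) := by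
    rw [div_le_iff₀ (by linarith)]
    nlinarith
  rw [piQ_refl hq1]
  linarith

lemma exists_lt_add_mod_eq {k t : ℕ} (ht : t < k) (n : ℕ) : ∃ j < k, (n + j) % k = t := by
  have hn := Nat.mod_lt n (show 0 < k by omega)
  rcases le_or_gt (n % k) t with h | h
  · refine ⟨t - n % k, by omega, ?_⟩
    rw [Nat.add_mod, Nat.mod_eq_of_lt (show t - n % k < k by omega), Nat.add_sub_cancel' h,
      Nat.mod_eq_of_lt ht]
  · refine ⟨t + k - n % k, by omega, ?_⟩
    rw [Nat.add_mod, Nat.mod_eq_of_lt (show t + k - n % k < k by omega),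
      Nat.add_sub_cancel' (by omega), Nat.add_mod_right, Nat.mod_eq_of_lt ht]

/-- Blocks of length `g + 2` beginning with the digits `0` and `M`, the remaining `g` digits being
taken from `b`. -/
def interleave (g : ℕ) (b : Digits M) : Digits M := fun n =>
  if n % (g + 2) = 0 then 0 else if n % (g + 2) = 1 then Fin.last M
  else b (g * (n / (g + 2)) + (n % (g + 2) - 2))

lemma interleave_free {g : ℕ} (hg : 0 < g) (b : Digits M) (i : ℕ) :
    interleave g b ((g + 2) * (i / g) + (2 + i % g)) = b i := by
  have hi := Nat.mod_lt i hg
  have h1 : ((g + 2) * (i / g) + (2 + i % g)) % (g + 2) = 2 + i % g := by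
    rw [Nat.mul_add_mod, Nat.mod_eq_of_lt (by omega)]
  have h2 : ((g + 2) * (i / g) + (2 + i % g)) / (g + 2) = i / g := by
    have : (2 + i % g) / (g + 2) = 0 := Nat.div_eq_of_lt (by omega)
    rw [Nat.mul_add_div (by omega), this, add_zero]
  rw [interleave, h1, h2, if_neg (by omega), if_neg (by omega), Nat.add_sub_cancel_left,
    Nat.div_add_mod]

lemma exists_interleave_zero (g : ℕ) (b : Digits M) (n : ℕ) :
    ∃ j < g + 2, interleave g b (n + j) = 0 := by
  obtain ⟨j, hj, h⟩ := exists_lt_add_mod_eq (k := g + 2) (t := 0) (by omega) n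
  exact ⟨j, hj, by rw [interleave, if_pos h]⟩

lemma exists_interleave_last (g : ℕ) (b : Digits M) (n : ℕ) :
    ∃ j < g + 2, interleave g b (n + j) = Fin.last M := by
  obtain ⟨j, hj, h⟩ := exists_lt_add_mod_eq (k := g + 2) (t := 1) (by omega) n
  exact ⟨j, hj, by rw [interleave, if_neg (by omega), if_pos h]⟩

lemma fin_last_ne_zero (hM : 0 < M) : Fin.last M ≠ 0 := fun h =>
  hM.ne' (by simpa using congrArg Fin.val h)

/-- Prepending a long prefix of the expansion `D` of `x` in base `M + 1` to an interleaved
sequence gives a univoque expansion of `x` in a base slightly smaller than `M + 1`. -/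
lemma exists_prep_interleave_mem_UxSym (hM : 0 < M) {x : ℝ} (hx : x ∈ Set.Ioc (0 : ℝ) 1) (g : ℕ) :
    ∃ (N : ℕ) (D : Digits M), ∀ b, prep N D (interleave g b) ∈ UxSym M x := by
  have hM1 : (1 : ℝ) ≤ M := by exact_mod_cast hM
  obtain ⟨D, hDx, hr⟩ := exists_quasiGreedy_integer_base hM hx
  obtain ⟨β, hβ⟩ : ∃ β : ℝ, β = M + 1 := ⟨_, rfl⟩
  rw [← hβ] at hDx
  simp only [← hβ] at hr
  have hβ2 : 2 ≤ β := by linarith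
  have hβ1 : 1 < β := by linarith
  have hβ0 : 0 < β := by linarith
  have hnz : ∀ n, ∃ m ≥ n, D m ≠ 0 := by
    intro n
    by_contra hcon
    push Not at hcon
    have h1 := (hr n).1
    have : piQ M β (shift n D) = 0 := by
      simp only [piQ, shift_apply]
      simp [fun i => hcon (n + i) (by omega)]
    linarith
  obtain ⟨a, -, ha⟩ := hnz 0
  obtain ⟨b₀, hab, hb₀⟩ := hnz (a + 5)
  obtain ⟨N, hN, hDN⟩ := hnz (a + b₀ + g + 6)
  refine ⟨N, D, fun b => ?_⟩
  set c := interleave g b with hc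
  set d := prep N D c with hd
  have hdD : ∀ i < N, d i = D i := fun i hi => by simp [hd, prep, hi]
  have hx0 : 0 < x := hx.1
  -- comparison of the expansions in base `β`
  have e1 := piQ_eq_prefix hβ1 D N
  have e2 := piQ_eq_prefix hβ1 d N
  rw [Finset.sum_congr rfl fun i hi => by rw [hdD i (Finset.mem_range.1 hi)], hd,
    shift_prep_self, ← hd] at e2
  have hc0 : c 0 = 0 := by simp [hc, interleave]
  have e3 : piQ M β c ≤ 1 / β := by
    rw [piQ_succ hβ1, hc0]
    have : piQ M β (shift 1 c) ≤ 1 := by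
      refine (piQ_le hβ1 _).trans_eq ?_
      rw [hβ, add_sub_cancel_right, div_self (by linarith)]
    gcongr
    simpa using this
  have e4 : 1 / β < piQ M β (shift N D) := by
    rw [piQ_shift_succ hβ1]
    have h1 := (hr (N + 1)).1
    have h2 : (1 : ℝ) ≤ (D N : ℕ) := by
      exact_mod_cast Nat.pos_of_ne_zero fun h => hDN (Fin.ext h)
    gcongr
    linarith
  have hlt : piQ M β d < x := by
    rw [← hDx, e1, e2]
    gcongr
    linarith
  have hgap : x - piQ M β d ≤ 1 / β ^ N := by
    rw [← hDx, e1, e2, add_sub_add_left_eq_sub, ← sub_div]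
    gcongr
    linarith [(hr N).2, piQ_nonneg hβ1 c]
  -- the smaller base
  have hδ : ∀ j, j + 1 + (a + 3) ≤ N → 2 * (β ^ (a + 2) / β ^ N) ≤ (β ^ (j + 1))⁻¹ := by
    intro j hj
    rw [← mul_div_assoc, div_le_iff₀ (by positivity), inv_mul_eq_div, le_div_iff₀ (by positivity)]
    calc 2 * β ^ (a + 2) * β ^ (j + 1) ≤ β * β ^ (a + 2) * β ^ (j + 1) := by gcongr
      _ = β ^ (j + 1 + (a + 3)) := by ring
      _ ≤ β ^ N := pow_le_pow_right₀ hβ1.le hj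
  have hδ0 : 0 < β ^ (a + 2) / β ^ N := by positivity
  have hδ1 : β ^ (a + 2) / β ^ N ≤ 1 / 2 := by
    have h1 := hδ 0 (by omega)
    have h2 : (β ^ (0 + 1))⁻¹ ≤ 1 := inv_le_one_of_one_le₀ (by simpa using hβ1.le)
    linarith
  set p := β - β ^ (a + 2) / β ^ N with hp
  have hp1 : 3 / 2 ≤ p := by linarith
  have hpβ : p ≤ β := by linarith
  have hxp : x ≤ piQ M p d := by
    have h1 := digit_sub_le_piQ_sub (by linarith) hpβ d a
    have h2 : (1 : ℝ) ≤ (d a : ℕ) := by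
      rw [hdD a (by omega)]
      exact_mod_cast Nat.pos_of_ne_zero fun h => ha (Fin.ext h)
    have hp0 : 0 < p := by linarith
    have h3 : 1 / β ^ N ≤ 1 / p ^ (a + 1) - 1 / β ^ (a + 1) := by
      have h4 : 1 / p ^ (a + 1) ≥ 1 / (β ^ a * p) := by
        rw [pow_succ]
        gcongr
      have h5 : 1 / (β ^ a * p) - 1 / β ^ (a + 1) = (β - p) / (β ^ (a + 1) * p) := by
        field_simp
        ring
      have h6 : (β - p) / (β ^ (a + 1) * β) ≤ (β - p) / (β ^ (a + 1) * p) := by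
        have : 0 ≤ β - p := by linarith
        gcongr
      have h7 : (β - p) / (β ^ (a + 1) * β) = 1 / β ^ N := by
        rw [hp]
        field_simp
        ring
      linarith
    have h8 : 1 / p ^ (a + 1) - 1 / β ^ (a + 1) ≤
        (d a : ℕ) / p ^ (a + 1) - (d a : ℕ) / β ^ (a + 1) := by
      rw [div_eq_mul_one_div ((d a : ℕ) : ℝ), div_eq_mul_one_div ((d a : ℕ) : ℝ) (β ^ _), ← mul_sub]
      refine le_mul_of_one_le_left ?_ h2
      have : (0 : ℝ) < 1 / β ^ N := by positivity
      linarith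
    linarith
  obtain ⟨q, hq, hqx⟩ := exists_base (by linarith) hpβ d hlt.le hxp
  have hqβ : q < β := lt_of_le_of_ne hq.2 fun h => hlt.ne (h ▸ hqx)
  have hq32 : 3 / 2 ≤ q := hp1.trans hq.1
  have hq1 : 1 < q := by linarith
  have hq0 : 0 < q := by linarith
  have hε : ∀ j, j + 1 + (a + 3) ≤ N → 2 * ((M : ℝ) + 1 - q) ≤ (((M : ℝ) + 1) ^ (j + 1))⁻¹ := by
    intro j hj
    rw [← hβ]
    linarith [hδ j hj, hq.1]
  have hshift : ∀ m, shift (N + m) d = shift m c := shift_prep N D c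
  rw [mem_UxSym_iff hx0]
  refine ⟨q, ⟨hq1, by linarith⟩, hqx, Tame.mem_UqSym hq1 ⟨fun n _ => ?_, fun n _ => ?_⟩⟩
  · rcases le_or_gt N (n + 1) with h | h
    · obtain ⟨m, hm⟩ := Nat.exists_eq_add_of_le h
      rw [hm, hshift]
      obtain ⟨j, hj, hcj⟩ := exists_interleave_zero g b m
      have := piQ_refl_lt_one_of_digit hq32 (hβ ▸ hqβ) (e := refl (shift m c)) (j := j)
        (by rw [refl_apply, shift_apply, hc, hcj, Fin.rev_zero]; exact fin_last_ne_zero hM)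
        (hε j (by omega))
      rwa [refl_refl] at this
    · have e5 := piQ_eq_prefix hq1 d (n + 1)
      have e6 := piQ_eq_prefix hβ1 D (n + 1)
      have e7 : ∑ i ∈ Finset.range (n + 1), (D i : ℝ) / β ^ (i + 1) ≤
          ∑ i ∈ Finset.range (n + 1), (d i : ℝ) / q ^ (i + 1) := by
        refine Finset.sum_le_sum fun i hi => ?_
        rw [hdD i (by have := Finset.mem_range.1 hi; omega)]
        gcongr
      have e8 : piQ M q (shift (n + 1) d) / q ^ (n + 1) < 1 / q ^ (n + 1) := by
        calc piQ M q (shift (n + 1) d) / q ^ (n + 1) ≤ piQ M β (shift (n + 1) D) / β ^ (n + 1) := by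
              linarith
          _ ≤ 1 / β ^ (n + 1) := by gcongr; exact (hr _).2
          _ < 1 / q ^ (n + 1) := by gcongr
      exact (div_lt_div_iff_of_pos_right (by positivity)).1 e8
  · obtain ⟨j, hj, hdj⟩ : ∃ j, j + 1 + (a + 3) ≤ N ∧ shift (n + 1) d j ≠ 0 := by
      have hcd : ∀ m, d (N + m) = c m := fun m => by simpa using congrFun (hshift m) 0
      rcases le_or_gt N (n + 1) with h | h
      · obtain ⟨m, hm⟩ := Nat.exists_eq_add_of_le h
        obtain ⟨j, hj, hcj⟩ := exists_interleave_last g b m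
        refine ⟨j, by omega, ?_⟩
        rw [hm, hshift, shift_apply, hc, hcj]
        exact fin_last_ne_zero hM
      · rcases le_or_gt (a + 5) (n + 1) with h5 | h5
        · refine ⟨N - n, by omega, ?_⟩
          rw [shift_apply, show n + 1 + (N - n) = N + 1 by omega, hcd, hc, interleave,
            Nat.mod_eq_of_lt (by omega), if_neg one_ne_zero, if_pos rfl]
          exact fin_last_ne_zero hM
        · refine ⟨b₀ - (n + 1), by omega, ?_⟩
          rw [shift_apply, Nat.add_sub_cancel' (by omega), hdD _ (by omega)]
          exact hb₀
    exact piQ_refl_lt_one_of_digit hq32 (hβ ▸ hqβ) hdj (hε j hj)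

lemma le_gdimH_UxSym (hM : 0 < M) {x : ℝ} (hx : x ∈ Set.Ioc (0 : ℝ) 1) {g : ℕ} (hg : 0 < g) :
    (((g : ℝ≥0) / (g + 2) : ℝ≥0) : ℝ≥0∞) ≤ gdimH (rho M) (UxSym M x) := by
  obtain ⟨N, D, h⟩ := exists_prep_interleave_mem_UxSym hM hx g
  have hβ := one_lt_cast_add_one hM
  have hβ0 : (0 : ℝ) < M + 1 := by linarith
  have hg' : (0 : ℝ) < g := by exact_mod_cast hg
  obtain ⟨r, hr⟩ : ∃ r : ℝ≥0, r = (g : ℝ≥0) / (g + 2) := ⟨_, rfl⟩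
  have hr' : (r : ℝ) = g / (g + 2) := by rw [hr]; push_cast; rfl
  have hr0 : 0 < r := by
    rw [← NNReal.coe_pos, hr']
    positivity
  rw [← hr]
  let C : ℝ≥0 := ⟨(((M : ℝ) + 1) ^ (N + (g + 2))) ^ (r : ℝ), by positivity⟩
  refine le_gdimH_of_decode hM (fun i => N + ((g + 2) * (i / g) + (2 + i % g))) id
    (fun b => ⟨_, h b, fun i => ?_⟩) hr0 (C := C) fun i => ?_
  · have := congrFun (shift_prep N D (interleave g b) ((g + 2) * (i / g) + (2 + i % g))) 0
    simpa [shift_apply, interleave_free hg] using this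
  · change _ ≤ (((M : ℝ) + 1) ^ (N + (g + 2))) ^ (r : ℝ) * _
    have h1 : (((M : ℝ) + 1) ^ ((g + 2) * (i / g))) ^ (r : ℝ) ≤ ((M : ℝ) + 1) ^ i := by
      rw [← Real.rpow_natCast, ← Real.rpow_mul hβ0.le,
        show (((g + 2) * (i / g) : ℕ) : ℝ) * (r : ℝ) = ((g * (i / g) : ℕ) : ℝ) by
          rw [hr']; push_cast; field_simp, Real.rpow_natCast]
      exact pow_le_pow_right₀ hβ.le (Nat.mul_div_le i g)
    have h2 : (((M : ℝ) + 1) ^ (N + ((g + 2) * (i / g) + (2 + i % g)) + 1)) ^ (r : ℝ) ≤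
        (((M : ℝ) + 1) ^ (N + (g + 2))) ^ (r : ℝ) * ((M : ℝ) + 1) ^ i := by
      refine le_trans ?_ (mul_le_mul_of_nonneg_left h1 (by positivity))
      rw [← Real.mul_rpow (by positivity) (by positivity), ← pow_add]
      have := Nat.mod_lt i hg
      refine Real.rpow_le_rpow (by positivity) (pow_le_pow_right₀ hβ.le (by omega)) r.coe_nonneg
    rw [Real.inv_rpow (by positivity), ← div_eq_mul_inv, le_div_iff₀ (by positivity),
      inv_mul_eq_div, div_le_iff₀ (by positivity)]
    exact h2

lemma gdimH_UxSym_eq_one (hM : 0 < M) {x : ℝ} (hx : x ∈ Set.Ioc (0 : ℝ) 1) :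
    gdimH (rho M) (UxSym M x) = 1 := by
  refine le_antisymm (gdimH_le_one hM _) ?_
  refine ENNReal.le_of_forall_nnreal_lt fun s hs => ?_
  rw [← ENNReal.coe_one, ENNReal.coe_lt_coe] at hs
  obtain ⟨n, hn⟩ := exists_nat_gt (2 / (1 - (s : ℝ)))
  have hs' : (0 : ℝ) < 1 - s := sub_pos.2 hs
  have hn0 : (0 : ℝ) < n := lt_trans (by positivity) hn
  refine le_trans (ENNReal.coe_le_coe.2 ?_) (le_gdimH_UxSym hM hx (Nat.cast_pos.1 hn0))
  rw [← NNReal.coe_le_coe]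
  push_cast
  rw [div_lt_iff₀ hs'] at hn
  rw [le_div_iff₀ (by positivity)]
  nlinarith [s.coe_nonneg]

end

/-- For `φ(x) = dim_H 𝐔(x)`: `φ(x) > 0` iff `x < M/(q_KL - 1)`, and `φ(x) = 1` iff
`0 < x ≤ 1`. -/
theorem phi_pos_iff_and_eq_one_iff (M : ℕ) (hM : 0 < M) (x : ℝ) (hx : 0 < x) :
    (0 < gdimH (rho M) (UxSym M x) ↔ x < (M : ℝ) / (qKL M - 1)) ∧
    (gdimH (rho M) (UxSym M x) = 1 ↔ x ≤ 1) := by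
  refine ⟨⟨fun h => ?_, fun h => ?_⟩, fun h => ?_, fun h => gdimH_UxSym_eq_one hM ⟨hx, h⟩⟩
  · by_contra hcon
    exact h.ne' (gdimH_UxSym_eq_zero hM hx (not_lt.1 hcon))
  · rcases le_or_gt x 1 with h1 | h1
    · rw [gdimH_UxSym_eq_one hM ⟨hx, h1⟩]
      exact zero_lt_one
    · exact gdimH_UxSym_pos hM h1 h
  · by_contra hcon
    exact (gdimH_UxSym_lt_one hM (not_le.1 hcon)).ne h

end Expansions
end

section
/- For every real x > 0, the set 𝒰(x) ⊆ (1, M+1] has Lebesgue measure zero. -/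
open scoped ENNReal NNReal Classical

namespace Expansions

open Filter Topology MeasureTheory

/-- The orbit `t₀ = x`, `tₙ₊₁ = q tₙ - dₙ` of remainders of `x` in base `q` along `d`. -/
noncomputable def remainder {M : ℕ} (d : Digits M) (x q : ℝ) : ℕ → ℝ
  | 0 => x
  | n + 1 => q * remainder d x q n - (d n : ℝ)

lemma digit_le {M : ℕ} (a : Fin (M + 1)) : ((a : ℕ) : ℝ) ≤ M := by
  exact_mod_cast Nat.lt_succ_iff.mp a.isLt

lemma hasSum_const_div_pow {q : ℝ} (hq : 1 < q) (c : ℝ) :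
    HasSum (fun i : ℕ => c / q ^ (i + 1)) (c / (q - 1)) := by
  have h := (hasSum_geometric_of_lt_one (r := q⁻¹) (by positivity)
    (inv_lt_one_of_one_lt₀ hq)).mul_left (c / q)
  have h1 : q - 1 ≠ 0 := by linarith
  have h0 : q ≠ 0 := by linarith
  have hterm : (fun i : ℕ => c / q ^ (i + 1)) = fun i => c / q * q⁻¹ ^ i := by
    funext i
    rw [inv_pow, pow_succ]
    field_simp
  have hval : c / (q - 1) = c / q * (1 - q⁻¹)⁻¹ := by
    have : 1 - q⁻¹ = (q - 1) / q := by field_simp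
    rw [this]
    field_simp
  rw [hterm, hval]
  exact h

lemma summable_digits {M : ℕ} {q : ℝ} (hq : 1 < q) (d : Digits M) :
    Summable (fun i : ℕ => ((d i : ℕ) : ℝ) / q ^ (i + 1)) := by
  refine Summable.of_nonneg_of_le (fun i => by positivity) (fun i => ?_)
    (hasSum_const_div_pow hq (M : ℝ)).summable
  have := digit_le (d i)
  gcongr

lemma piQ_mem_Icc {M : ℕ} {q : ℝ} (hq : 1 < q) (d : Digits M) :
    piQ M q d ∈ Set.Icc 0 ((M : ℝ) / (q - 1)) := by
  refine ⟨tsum_nonneg fun i => by positivity, ?_⟩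
  rw [← (hasSum_const_div_pow hq (M : ℝ)).tsum_eq]
  refine (summable_digits hq d).tsum_le_tsum (fun i => ?_)
    (hasSum_const_div_pow hq (M : ℝ)).summable
  have := digit_le (d i)
  gcongr

lemma piQ_eq_head_add_tail {M : ℕ} {q : ℝ} (hq : 1 < q) (d : Digits M) :
    piQ M q d = ((d 0 : ℝ) + piQ M q (fun i => d (i + 1))) / q := by
  have h0 : q ≠ 0 := by linarith
  unfold piQ
  rw [(summable_digits hq d).tsum_eq_zero_add, add_div, ← tsum_div_const]
  congr 1
  · simp
  · refine tsum_congr fun i => ?_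
    rw [pow_succ q (i + 1)]
    field_simp

lemma remainder_piQ {M : ℕ} {q : ℝ} (hq : 1 < q) (d : Digits M) (n : ℕ) :
    remainder d (piQ M q d) q n = piQ M q (fun i => d (i + n)) := by
  induction n with
  | zero => rfl
  | succ n ih =>
    have h0 : q ≠ 0 := by linarith
    rw [remainder, ih, piQ_eq_head_add_tail hq (fun i => d (i + n))]
    have : (fun i => d (i + 1 + n)) = fun i => d (i + (n + 1)) := by
      funext i
      congr 1
      omega
    rw [mul_div_cancel₀ _ h0, this]
    simp

lemma piQ_eq_of_bounded_remainder {M : ℕ} {q y B : ℝ} (hq : 1 < q) (d : Digits M)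
    (hB : ∀ n, |remainder d y q n| ≤ B) : piQ M q d = y := by
  have hq0 : 0 < q := by linarith
  have hs : ∀ n, ∑ i ∈ Finset.range n, ((d i : ℕ) : ℝ) / q ^ (i + 1)
      = y - remainder d y q n / q ^ n := by
    intro n
    induction n with
    | zero => simp [remainder]
    | succ n ih =>
      rw [Finset.sum_range_succ, ih, remainder, pow_succ]
      field_simp
      ring
  have hlim : Tendsto (fun n => remainder d y q n / q ^ n) atTop (𝓝 0) := by
    have hg : Tendsto (fun n : ℕ => B * q⁻¹ ^ n) atTop (𝓝 0) := by
      simpa using (tendsto_pow_atTop_nhds_zero_of_lt_one (by positivity)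
        (inv_lt_one_of_one_lt₀ hq)).const_mul B
    refine squeeze_zero_norm (fun n => ?_) hg
    rw [Real.norm_eq_abs, abs_div, abs_of_pos (pow_pos hq0 n), inv_pow, ← div_eq_mul_inv]
    have := hB n
    gcongr
  have h1 := (summable_digits hq d).hasSum.tendsto_sum_nat
  simp only [hs] at h1
  have h2 := hlim.const_sub y
  rw [sub_zero] at h2
  exact tendsto_nhds_unique h1 h2

/-- Every point of `[0, M/(q-1)]` has an expansion in base `q ∈ (1, M+1]`. -/
lemma exists_piQ_eq {M : ℕ} {q y : ℝ} (hq : 1 < q) (hqM : q ≤ M + 1)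
    (hy : y ∈ Set.Icc 0 ((M : ℝ) / (q - 1))) : ∃ d : Digits M, piQ M q d = y := by
  have hq1 : 0 < q - 1 := by linarith
  let g : ℝ → Fin (M + 1) := fun t => ⟨min M ⌊q * t⌋₊, by omega⟩
  have hg : ∀ t ∈ Set.Icc 0 ((M : ℝ) / (q - 1)),
      q * t - (g t : ℕ) ∈ Set.Icc 0 ((M : ℝ) / (q - 1)) := by
    rintro t ⟨ht0, ht1⟩
    have hqt : 0 ≤ q * t := by positivity
    have hfl := Nat.floor_le hqt
    rw [le_div_iff₀ hq1] at ht1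
    simp only [g, Set.mem_Icc, Nat.cast_min]
    refine ⟨by linarith [min_le_right (M : ℝ) (⌊q * t⌋₊ : ℝ)], ?_⟩
    rw [le_div_iff₀ hq1]
    rcases min_choice (M : ℝ) (⌊q * t⌋₊ : ℝ) with h | h <;> rw [h]
    · nlinarith
    · nlinarith [Nat.lt_floor_add_one (q * t)]
  let t : ℕ → ℝ := fun n => (fun s => q * s - (g s : ℕ))^[n] y
  have ht : ∀ n, t n ∈ Set.Icc 0 ((M : ℝ) / (q - 1)) := by
    intro n
    induction n with
    | zero => exact hy
    | succ n ih =>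
      simp only [t, Function.iterate_succ_apply']
      exact hg _ ih
  have hrem : ∀ n, remainder (fun n => g (t n)) y q n = t n := by
    intro n
    induction n with
    | zero => rfl
    | succ n ih =>
      rw [remainder, ih]
      simp only [t, Function.iterate_succ_apply']
  refine ⟨fun n => g (t n), piQ_eq_of_bounded_remainder (B := (M : ℝ) / (q - 1)) hq _ fun n => ?_⟩
  rw [hrem, abs_of_nonneg (ht n).1]
  exact (ht n).2

lemma piQ_cons {M : ℕ} {q : ℝ} (hq : 1 < q) (a : Fin (M + 1)) (d : Digits M) :
    piQ M q (fun i => Nat.casesOn i a d) = ((a : ℕ) + piQ M q d) / q :=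
  piQ_eq_head_add_tail hq _

/-- Points of the switch region `[1/q, M/(q(q-1))]` have several expansions. -/
lemma not_mem_Uq_of_switch {M : ℕ} (hM : 0 < M) {q t : ℝ} (hq : 1 < q) (hqM : q ≤ M + 1)
    (h1 : 1 ≤ q * t) (h2 : q * t ≤ (M : ℝ) / (q - 1)) : t ∉ Uq M q := by
  rintro ⟨c, -, hc⟩
  have hq0 : q ≠ 0 := by linarith
  obtain ⟨d, hd⟩ := exists_piQ_eq hq hqM (y := q * t) ⟨by linarith, h2⟩
  obtain ⟨e, he⟩ := exists_piQ_eq hq hqM (y := q * t - 1) ⟨by linarith, by linarith⟩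
  have hd' := hc _ (show piQ M q (fun i => Nat.casesOn i 0 d) = t by
    rw [piQ_cons hq, hd]
    simp [hq0])
  have he' := hc _ (show piQ M q (fun i => Nat.casesOn i ⟨1, by omega⟩ e) = t by
    rw [piQ_cons hq, he]
    simp [hq0])
  have := congrArg Fin.val (congrFun (hd'.trans he'.symm) 0)
  simp at this

lemma remainder_mem_Uq {M : ℕ} {q x : ℝ} (hq : 1 < q) (d : Digits M) (hx : x ∈ Uq M q)
    {n : ℕ} (hn : ∃ e, piQ M q e = remainder d x q n) :
    remainder d x q n ∈ Uq M q := by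
  have hq0 : q ≠ 0 := by linarith
  induction n with
  | zero => exact hx
  | succ n ih =>
    have key : ∀ e, piQ M q e = remainder d x q (n + 1) →
        piQ M q (fun i => Nat.casesOn i (d n) e) = remainder d x q n := by
      intro e he
      rw [piQ_cons hq, he, remainder]
      field_simp
      ring
    obtain ⟨e, he⟩ := hn
    obtain ⟨c, -, hc⟩ := ih ⟨_, key e he⟩
    refine ⟨e, he, fun f hf => ?_⟩
    have h := (hc _ (key f hf)).trans (hc _ (key e he)).symm
    funext i
    exact congrFun h (i + 1)

lemma not_mem_Uq_of_remainder_switch {M : ℕ} (hM : 0 < M) {q x : ℝ} (hq : 1 < q)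
    (hqM : q ≤ M + 1) (d : Digits M) (n : ℕ) (h1 : 1 ≤ q * remainder d x q n)
    (h2 : q * remainder d x q n ≤ (M : ℝ) / (q - 1)) : x ∉ Uq M q := by
  intro hx
  have hr0 : 0 ≤ remainder d x q n := by nlinarith
  have hr1 : remainder d x q n ≤ (M : ℝ) / (q - 1) := by nlinarith
  exact not_mem_Uq_of_switch hM hq hqM h1 h2
    (remainder_mem_Uq hq d hx (exists_piQ_eq hq hqM ⟨hr0, hr1⟩))

lemma continuous_remainder {M : ℕ} (d : Digits M) (x : ℝ) (n : ℕ) :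
    Continuous fun q => remainder d x q n := by
  induction n with
  | zero => exact continuous_const
  | succ n ih =>
    simp only [remainder]
    fun_prop

lemma remainder_mem_Icc_of_le {M : ℕ} {q x : ℝ} (hq : 1 < q) (d : Digits M) {n : ℕ}
    (hn : remainder d x q n ∈ Set.Icc 0 ((M : ℝ) / (q - 1))) {k : ℕ} (hk : k ≤ n) :
    remainder d x q k ∈ Set.Icc 0 ((M : ℝ) / (q - 1)) := by
  have hq1 : 0 < q - 1 := by linarith
  induction hk using Nat.decreasingInduction with
  | self => exact hn
  | of_succ k _ ih =>
    obtain ⟨h0, h1⟩ := ih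
    rw [remainder] at h0 h1
    have hd := digit_le (d k)
    have hd0 : (0 : ℝ) ≤ ((d k : ℕ) : ℝ) := by positivity
    rw [le_div_iff₀ hq1] at h1
    refine ⟨by nlinarith, ?_⟩
    rw [le_div_iff₀ hq1]
    nlinarith

lemma abs_remainder_sub_le {M : ℕ} {p q x B : ℝ} (hq : 1 < q) (d : Digits M) (n : ℕ)
    (hB : ∀ k ≤ n, |remainder d x p k| ≤ B) :
    |remainder d x q n - remainder d x p n| ≤ |q - p| * B * (q ^ n / (q - 1)) := by
  have hq1 : 0 < q - 1 := by linarith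
  have hB0 : 0 ≤ B := (abs_nonneg _).trans (hB 0 (Nat.zero_le n))
  suffices H : ∀ k ≤ n, |remainder d x q k - remainder d x p k|
      ≤ |q - p| * B * ((q ^ k - 1) / (q - 1)) by
    refine (H n le_rfl).trans ?_
    gcongr
    linarith
  intro k
  induction k with
  | zero => simp [remainder]
  | succ k ih =>
    intro hk
    have e : remainder d x q (k + 1) - remainder d x p (k + 1)
        = q * (remainder d x q k - remainder d x p k) + (q - p) * remainder d x p k := by
      simp only [remainder]
      ring
    rw [e]
    refine (abs_add_le _ _).trans ?_
    rw [abs_mul, abs_mul, abs_of_pos (by linarith : 0 < q)]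
    calc q * |remainder d x q k - remainder d x p k| + |q - p| * |remainder d x p k|
        ≤ q * (|q - p| * B * ((q ^ k - 1) / (q - 1))) + |q - p| * B := by
          gcongr
          · exact ih (by omega)
          · exact hB k (by omega)
      _ = |q - p| * B * ((q ^ (k + 1) - 1) / (q - 1)) := by
          rw [pow_succ]
          field_simp
          ring

lemma le_remainder_sub {M : ℕ} {p q x : ℝ} (hp : 0 < p) (hpq : p ≤ q) (d : Digits M)
    (h : ∀ k, 0 ≤ remainder d x p k) {n : ℕ} (hn : 1 ≤ n) :
    (q - p) * x * q ^ n ≤ q * (remainder d x q n - remainder d x p n) := by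
  induction n, hn using Nat.le_induction with
  | base => simp only [remainder]; nlinarith
  | succ n _ ih =>
    have e : remainder d x q (n + 1) - remainder d x p (n + 1)
        = q * (remainder d x q n - remainder d x p n) + (q - p) * remainder d x p n := by
      simp only [remainder]
      ring
    have h1 : 0 ≤ (q - p) * remainder d x p n := mul_nonneg (by linarith) (h n)
    rw [e, pow_succ]
    nlinarith

lemma le_sub_remainder {M : ℕ} {p q x : ℝ} (hq : 0 < q) (hpq : q ≤ p) (d : Digits M)
    (h : ∀ k, 0 ≤ remainder d x p k) {n : ℕ} (hn : 1 ≤ n) :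
    (p - q) * x * q ^ n ≤ q * (remainder d x p n - remainder d x q n) := by
  induction n, hn using Nat.le_induction with
  | base => simp only [remainder]; nlinarith
  | succ n _ ih =>
    have e : remainder d x p (n + 1) - remainder d x q (n + 1)
        = q * (remainder d x p n - remainder d x q n) + (p - q) * remainder d x p n := by
      simp only [remainder]
      ring
    have h1 : 0 ≤ (p - q) * remainder d x p n := mul_nonneg (by linarith) (h n)
    rw [e, pow_succ]
    nlinarith

/-- On windows of size `O(p⁻ⁿ)` around `p > 1`, the `n`-th power is comparable to `pⁿ`. -/
lemma eventually_pow_comparable {p : ℝ} (hp : 1 < p) (C : ℝ) :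
    ∀ᶠ n : ℕ in atTop, ∀ q, |q - p| ≤ C * p⁻¹ ^ n →
      p ^ n / 2 ≤ q ^ n ∧ q ^ n ≤ 2 * p ^ n := by
  have hp0 : 0 < p := by linarith
  have hlim : Tendsto (fun n : ℕ => C * (n * p⁻¹ ^ n)) atTop (𝓝 0) := by
    simpa using (tendsto_self_mul_const_pow_of_lt_one (by positivity)
      (inv_lt_one_of_one_lt₀ hp)).const_mul C
  filter_upwards [hlim.eventually (gt_mem_nhds (by norm_num : (0 : ℝ) < 1 / 2)),
    eventually_ge_atTop 1] with n hn hn1 q hq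
  have hn1' : (1 : ℝ) ≤ n := by exact_mod_cast hn1
  set s := |q - p| / p with hs
  have hs0 : 0 ≤ s := by positivity
  have hns : n * s ≤ 1 / 2 := by
    have : s ≤ |q - p| := div_le_self (abs_nonneg _) hp.le
    nlinarith
  have hs1 : s ≤ 1 / 2 := by nlinarith
  have hps : p * s = |q - p| := by rw [hs]; field_simp
  have hlow : 1 / 2 ≤ (1 - s) ^ n := by
    have := one_add_mul_le_pow (a := -s) (by linarith) n
    rw [← sub_eq_add_neg] at this
    linarith
  have hup : (1 + s) ^ n ≤ 2 := by
    have h1 : (1 + s) ^ n * (1 - s) ^ n ≤ 1 := by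
      rw [← mul_pow]
      exact pow_le_one₀ (by nlinarith) (by nlinarith)
    have h2 : 0 ≤ (1 + s) ^ n := by positivity
    nlinarith
  have ha := abs_le.mp hps.ge
  have hql : p * (1 - s) ≤ q := by linarith
  have hqu : q ≤ p * (1 + s) := by linarith
  have hpn : 0 < p ^ n := by positivity
  constructor
  · calc p ^ n / 2 ≤ p ^ n * (1 - s) ^ n := by nlinarith
      _ = (p * (1 - s)) ^ n := (mul_pow _ _ _).symm
      _ ≤ q ^ n := pow_le_pow_left₀ (by nlinarith) hql n
  · calc q ^ n ≤ (p * (1 + s)) ^ n := pow_le_pow_left₀ (by nlinarith) hqu n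
      _ = p ^ n * (1 + s) ^ n := mul_pow _ _ _
      _ ≤ 2 * p ^ n := by nlinarith

lemma exists_remainder_eq {M : ℕ} {p x r τ B : ℝ} (hx : 0 < x) (hr : 0 < r) (hpr : r < p)
    (d : Digits M) (hrem : ∀ k, remainder d x p k ∈ Set.Icc 0 B) (hτ : 0 < τ) {n : ℕ}
    (hn : 1 ≤ n) (hB : r * p ^ n * x = 2 * p * (B + τ)) (hpow : p ^ n / 2 ≤ (p - r) ^ n) :
    ∃ c ∈ Set.Icc (p - r) (p + r), remainder d x c n = τ := by
  have hp : 0 < p := hr.trans hpr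
  have hrx : 0 < r * x := by positivity
  have hB0 : 0 ≤ B := (hrem 0).1.trans (hrem 0).2
  have hright : τ ≤ remainder d x (p + r) n := by
    have h := le_remainder_sub hp (by linarith : p ≤ p + r) d (fun k => (hrem k).1) hn
    have h1 : p ^ n ≤ (p + r) ^ n := pow_le_pow_left₀ hp.le (by linarith) n
    rw [add_sub_cancel_left] at h
    have h2 : 2 * p * (B + τ) ≤ (p + r) * (remainder d x (p + r) n - remainder d x p n) := by
      rw [← hB]
      nlinarith
    have h3 := (hrem n).1
    by_contra! hlt
    have h4 : (p + r) * (remainder d x (p + r) n - remainder d x p n) < (p + r) * τ :=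
      mul_lt_mul_of_pos_left (by linarith) (by linarith)
    nlinarith
  have hleft : remainder d x (p - r) n ≤ τ := by
    have h := le_sub_remainder (by linarith : 0 < p - r) (by linarith : p - r ≤ p) d
      (fun k => (hrem k).1) hn
    rw [sub_sub_cancel] at h
    have h2 : p * (B + τ) ≤ (p - r) * (remainder d x p n - remainder d x (p - r) n) := by
      nlinarith
    have h3 := (hrem n).2
    by_contra! hlt
    have h4 : (p - r) * (remainder d x p n - remainder d x (p - r) n) ≤ (p - r) * B :=
      mul_le_mul_of_nonneg_left (by linarith) (by linarith)
    nlinarith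
  obtain ⟨c, hc, hcτ⟩ := intermediate_value_Icc (by linarith : p - r ≤ p + r)
    (continuous_remainder d x n).continuousOn ⟨hleft, hright⟩
  exact ⟨c, hc, hcτ⟩

/-- `Ubases M x` is porous at each of its points below `M + 1`. -/
lemma exists_hole {M : ℕ} (hM : 0 < M) {x p : ℝ} (hx : 0 < x) (hp : 1 < p) (hpM : p < M + 1)
    (d : Digits M) (hd : piQ M p d = x) :
    ∃ C > 0, ∃ κ > 0, κ ≤ 1 ∧ ∀ᶠ n : ℕ in atTop, ∃ c, |c - p| ≤ C * p⁻¹ ^ n ∧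
      Disjoint (Ubases M x) (Metric.closedBall c (κ * (C * p⁻¹ ^ n))) := by
  have hp0 : 0 < p := by linarith
  have hp1 : 0 < p - 1 := by linarith
  have hM' : (0 : ℝ) < M := by exact_mod_cast hM
  have hr : ∀ k, remainder d x p k ∈ Set.Icc 0 ((M : ℝ) / (p - 1)) := by
    intro k
    rw [← hd, remainder_piQ hp]
    exact piQ_mem_Icc hp _
  obtain ⟨σ, hσ1, hσ2⟩ := exists_between (show 1 < (M : ℝ) / (p - 1) by
    rw [one_lt_div hp1]; linarith)
  set τ := σ / p with hτ
  have hτ0 : 0 < τ := by positivity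
  have hpτ : p * τ = σ := by rw [hτ]; field_simp
  have hswitch : ∀ᶠ z : ℝ × ℝ in 𝓝 (p, τ), 1 < z.1 ∧ z.1 < M + 1 ∧ (p - 1) / 2 < z.1 - 1 ∧
      1 < z.1 * z.2 ∧ z.1 * z.2 * (z.1 - 1) < M := by
    rw [lt_div_iff₀ hp1] at hσ2
    refine .and ?_ (.and ?_ (.and ?_ (.and ?_ ?_)))
    · exact ContinuousAt.eventually_lt (by fun_prop) (by fun_prop) hp
    · exact ContinuousAt.eventually_lt (by fun_prop) (by fun_prop) hpM
    · exact ContinuousAt.eventually_lt (by fun_prop) (by fun_prop) (by simp only; linarith)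
    · exact ContinuousAt.eventually_lt (by fun_prop) (by fun_prop) (by simp only [hpτ]; exact hσ1)
    · exact ContinuousAt.eventually_lt (by fun_prop) (by fun_prop) (by simp only [hpτ]; exact hσ2)
  obtain ⟨ε, hε, hball⟩ := Metric.eventually_nhds_iff.mp hswitch
  have hsw : ∀ q t, |q - p| < ε → |t - τ| < ε → 1 < q ∧ q < M + 1 ∧ (p - 1) / 2 < q - 1 ∧
      1 < q * t ∧ q * t * (q - 1) < M := by
    intro q t h1 h2
    refine @hball (q, t) ?_
    rw [Prod.dist_eq, max_lt_iff]
    exact ⟨h1, h2⟩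
  set B := (M : ℝ) / (p - 1) with hB
  have hB0 : 0 < B := by positivity
  set C := 2 * p * (B + τ) / x with hC
  have hC0 : 0 < C := by positivity
  have hCx : C * x = 2 * p * (B + τ) := by rw [hC]; field_simp
  set K := 2 * C * (2 * B) * (2 / (p - 1)) with hK
  have hK0 : 0 < K := by positivity
  set κ := min 1 (ε / (2 * K)) with hκ
  have hκ0 : 0 < κ := by positivity
  have hκK : κ * K < ε := by
    calc κ * K ≤ ε / (2 * K) * K := by gcongr; exact min_le_right _ _
      _ = ε / 2 := by field_simp
      _ < ε := by linarith
  refine ⟨C, hC0, κ, hκ0, min_le_left _ _, ?_⟩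
  have hlim : Tendsto (fun n : ℕ => 2 * C * p⁻¹ ^ n) atTop (𝓝 0) := by
    simpa using (tendsto_pow_atTop_nhds_zero_of_lt_one (by positivity)
      (inv_lt_one_of_one_lt₀ hp)).const_mul (2 * C)
  filter_upwards [hlim.eventually (gt_mem_nhds hε), eventually_pow_comparable hp (2 * C),
    eventually_ge_atTop 1] with n hnε hpow hn1
  set r := C * p⁻¹ ^ n with hr_def
  have hr0 : 0 < r := by positivity
  have hrp : r * p ^ n = C := by
    rw [hr_def, inv_pow]
    field_simp
  have h2r : 2 * C * p⁻¹ ^ n = 2 * r := by rw [hr_def]; ring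
  rw [h2r] at hnε hpow
  have hnear : ∀ q, |q - p| ≤ r → 1 < q := fun q hq =>
    (hsw q τ (by linarith) (by simpa using hε)).1
  have hpr := hnear (p - r) (by simp [abs_of_pos hr0])
  obtain ⟨c, hc, hcτ⟩ := exists_remainder_eq hx hr0 (by linarith) d hr hτ0 hn1
    (by rw [hrp, hCx]) (hpow (p - r) (by simp [abs_of_pos hr0]; linarith)).1
  have hcp : |c - p| ≤ r := by
    rw [abs_le]
    constructor <;> linarith [hc.1, hc.2]
  refine ⟨c, hcp, ?_⟩
  obtain ⟨hc1, -, hc2, hc3, hc4⟩ := hsw c τ (by linarith) (by simpa using hε)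
  have hc1' : 0 < c - 1 := by linarith
  have hcB : ∀ k ≤ n, |remainder d x c k| ≤ 2 * B := by
    intro k hk
    have hmem : remainder d x c n ∈ Set.Icc 0 ((M : ℝ) / (c - 1)) := by
      rw [hcτ]
      refine ⟨hτ0.le, ?_⟩
      rw [le_div_iff₀ hc1']
      nlinarith [mul_pos hτ0 hc1']
    obtain ⟨h0, h1⟩ := remainder_mem_Icc_of_le hc1 d hmem hk
    rw [abs_of_nonneg h0]
    refine h1.trans ?_
    rw [div_le_iff₀ hc1']
    have : B * (p - 1) = M := by rw [hB]; field_simp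
    nlinarith
  rw [Set.disjoint_left]
  intro q hqU hq
  rw [Metric.mem_closedBall, Real.dist_eq] at hq
  have hκ1 : κ * r ≤ r := mul_le_of_le_one_left hr0.le (min_le_left _ _)
  have hqp : |q - p| ≤ 2 * r := by
    have := abs_sub_le q c p
    linarith
  obtain ⟨hq1, hqM, hq2, -, -⟩ := hsw q τ (by linarith) (by simpa using hε)
  have hqτ : |remainder d x q n - τ| < ε := by
    have h := abs_remainder_sub_le hq1 d n hcB
    rw [hcτ] at h
    refine h.trans_lt (lt_of_le_of_lt ?_ hκK)
    calc |q - c| * (2 * B) * (q ^ n / (q - 1))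
        ≤ (κ * r) * (2 * B) * (2 * p ^ n / ((p - 1) / 2)) := by
          have := (hpow q hqp).2
          gcongr
      _ = κ * K := by
          rw [hK, ← hrp]
          field_simp
  obtain ⟨-, -, -, h1, h2⟩ := hsw q _ (by linarith) hqτ
  refine not_mem_Uq_of_remainder_switch hM hq1 hqM.le d n h1.le ?_ hqU.2
  rw [le_div_iff₀ (by linarith)]
  exact h2.le

/-- A set of reals which is porous at each of its points is null. -/
lemma volume_eq_zero_of_porous {S : Set ℝ}
    (h : ∀ p ∈ S, ∃ κ > 0, κ ≤ 1 ∧ ∃ r : ℕ → ℝ, Tendsto r atTop (𝓝[>] 0) ∧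
      ∀ᶠ n in atTop, ∃ c, |c - p| ≤ r n ∧ Disjoint S (Metric.closedBall c (κ * r n))) :
    volume S = 0 := by
  have hae := Besicovitch.ae_tendsto_measure_inter_div (volume : Measure ℝ) S
  have hS : ∀ p ∈ S, ¬ Tendsto (fun r => volume (S ∩ Metric.closedBall p r) /
      volume (Metric.closedBall p r)) (𝓝[>] 0) (𝓝 1) := by
    intro p hpS hlim
    obtain ⟨κ, hκ, hκ1, r, hr, hev⟩ := h p hpS
    have hr2 : Tendsto (fun n => 2 * r n) atTop (𝓝[>] 0) := by
      rw [tendsto_nhdsWithin_iff] at hr ⊢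
      refine ⟨by simpa using hr.1.const_mul 2, hr.2.mono fun n hn => ?_⟩
      simp only [Set.mem_Ioi] at hn ⊢
      linarith
    have hlim' := hlim.comp hr2
    have hbound : ∀ᶠ n in atTop, volume (S ∩ Metric.closedBall p (2 * r n)) /
        volume (Metric.closedBall p (2 * r n)) ≤ ENNReal.ofReal (1 - κ / 2) := by
      filter_upwards [hev, (tendsto_nhdsWithin_iff.mp hr).2] with n ⟨c, hc, hdisj⟩ hrn
      have hrn0 : 0 < r n := hrn
      have hsub : Metric.closedBall c (κ * r n) ⊆ Metric.closedBall p (2 * r n) :=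
        Metric.closedBall_subset_closedBall' (by rw [Real.dist_eq]; nlinarith)
      have hle : volume (S ∩ Metric.closedBall p (2 * r n)) ≤
          ENNReal.ofReal (4 * r n - 2 * (κ * r n)) := by
        calc volume (S ∩ Metric.closedBall p (2 * r n))
            ≤ volume (Metric.closedBall p (2 * r n) \ Metric.closedBall c (κ * r n)) :=
              measure_mono fun y hy => ⟨hy.2, Set.disjoint_left.mp hdisj hy.1⟩
          _ = ENNReal.ofReal (4 * r n - 2 * (κ * r n)) := by
              rw [measure_sdiff hsub measurableSet_closedBall.nullMeasurableSet
                measure_closedBall_lt_top.ne, Real.volume_closedBall, Real.volume_closedBall,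
                ← ENNReal.ofReal_sub _ (by positivity)]
              congr 1
              ring
      calc _ ≤ ENNReal.ofReal (4 * r n - 2 * (κ * r n)) / ENNReal.ofReal (2 * (2 * r n)) := by
            rw [Real.volume_closedBall]
            gcongr
        _ = ENNReal.ofReal (1 - κ / 2) := by
            rw [← ENNReal.ofReal_div_of_pos (by positivity)]
            congr 1
            field_simp
            ring
    have := le_of_tendsto hlim' hbound
    rw [← ENNReal.ofReal_one, ENNReal.ofReal_le_ofReal_iff (by linarith)] at this
    linarith
  rw [ae_iff] at hae
  refine le_antisymm (le_trans ?_ ((Measure.le_restrict_apply S _).trans hae.le)) zero_le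
  exact measure_mono fun p hp => ⟨hS p hp, hp⟩

/-- For every `x > 0`, the set `𝒰(x)` has Lebesgue measure zero. -/
theorem Ubases_measure_zero (M : ℕ) (hM : 0 < M) (x : ℝ) (hx : 0 < x) :
    MeasureTheory.volume (Ubases M x) = 0 := by
  have hnull : volume (Ubases M x ∩ Set.Iio ((M : ℝ) + 1)) = 0 := by
    refine volume_eq_zero_of_porous ?_
    rintro p ⟨⟨hp, d, hd, -⟩, hpM⟩
    obtain ⟨C, hC, κ, hκ, hκ1, hev⟩ := exists_hole hM hx hp.1 hpM d hd
    have hp0 : 0 < p := by linarith [hp.1]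
    refine ⟨κ, hκ, hκ1, fun n => C * p⁻¹ ^ n, ?_, hev.mono fun n ⟨c, hc, hdisj⟩ =>
      ⟨c, hc, hdisj.mono_left Set.inter_subset_left⟩⟩
    refine tendsto_nhdsWithin_iff.mpr ⟨?_, .of_forall fun n => ?_⟩
    · simpa using (tendsto_pow_atTop_nhds_zero_of_lt_one (by positivity)
        (inv_lt_one_of_one_lt₀ hp.1)).const_mul C
    · simp only [Set.mem_Ioi]
      positivity
  refine measure_mono_null (t := Ubases M x ∩ Set.Iio ((M : ℝ) + 1) ∪ {(M : ℝ) + 1}) ?_ ?_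
  · intro q hq
    rcases hq.1.2.lt_or_eq with h | h
    · exact Or.inl ⟨hq, h⟩
    · exact Or.inr h
  · exact measure_union_null hnull (by simp)

end Expansions
end
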